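/- arXiv:1404.4000 — 6 statements merged into one kernel-verified Lean document; each statement's English description precedes it below -/
import Mathlib

section
/- The assignment sending a pair (V,V') ∈ X×X to the N×N matrix A=(a_{ij}) with a_{ij} = dim_{F_q}((V_{i−1}+V_i∩V'_j)/(V_{i−1}+V_i∩V'_{j−1})) is constant on O(D)-orbits and induces a bijection from the set of O(D)-orbits on X×X (diagonal action) onto Ξ_d. Likewise, the assignment sending (V,F) ∈ X×Y to the N×D matrix B=(b_{ij}) with b_{ij} = dim_{F_q}((V_{i−1}+V_i∩F_j)/(V_{i−1}+V_i∩F_{j−1})) induces a bijection from the set of O(D)-orbits on X×Y onto Π. -/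
noncomputable section

open Module

/-- The orthogonal complement of a subspace `W` with respect to a bilinear form `Q`. -/
def orthB {F M : Type} [Field F] [AddCommGroup M] [Module F M]
    (Q : M →ₗ[F] M →ₗ[F] F) (W : Submodule F M) : Submodule F M where
  carrier := {u | ∀ w ∈ W, Q u w = 0}
  add_mem' := by
    intro a b ha hb w hw
    simp [map_add, LinearMap.add_apply, ha w hw, hb w hw]
  zero_mem' := by
    intro w hw
    simp
  smul_mem' := by
    intro c a ha w hw
    simp [map_smul, LinearMap.smul_apply, smul_eq_mul, ha w hw]

/-- `g` belongs to the isometry group of the bilinear form `Q` (for symmetric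
nondegenerate `Q` on `𝔽_q^D` this is the orthogonal group `O(D)`). -/
def inIsom {F M : Type} [Field F] [AddCommGroup M] [Module F M]
    (Q : M →ₗ[F] M →ₗ[F] F) (g : M ≃ₗ[F] M) : Prop :=
  ∀ u u', Q (g u) (g u') = Q u u'

/-- `V` is a point of `X`: an `N`-step flag (`N = 2n+1`) in `𝔽_q^D` (`D = 2d+1`) with
`V_i = V_{N−i}^⊥` for all `i`. -/
def IsXFlag (n d : ℕ) (F : Type) [Field F]
    (Q : (Fin (2*d+1) → F) →ₗ[F] (Fin (2*d+1) → F) →ₗ[F] F)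
    (V : Fin (2*n+1+1) → Submodule F (Fin (2*d+1) → F)) : Prop :=
  Monotone V ∧ V 0 = ⊥ ∧ V (Fin.last (2*n+1)) = ⊤ ∧ ∀ i, V i = orthB Q (V i.rev)

/-- `Fl` is a point of `Y`: a complete flag in `𝔽_q^D` (`D = 2d+1`) with
`dim Fl_i = i` and `Fl_i = Fl_{D−i}^⊥` for all `i`. -/
def IsYFlag (d : ℕ) (F : Type) [Field F]
    (Q : (Fin (2*d+1) → F) →ₗ[F] (Fin (2*d+1) → F) →ₗ[F] F)
    (Fl : Fin (2*d+1+1) → Submodule F (Fin (2*d+1) → F)) : Prop :=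
  Monotone Fl ∧ Fl 0 = ⊥ ∧ Fl (Fin.last (2*d+1)) = ⊤
    ∧ (∀ i, finrank F (Fl i) = (i : ℕ)) ∧ ∀ i, Fl i = orthB Q (Fl i.rev)

/-- The `N×N` matrix associated to a pair of `N`-step flags:
`a_{ij} = dim (V_{i−1} + V_i ∩ V'_j) − dim (V_{i−1} + V_i ∩ V'_{j−1})`
(`= dim ((V_{i−1} + V_i ∩ V'_j)/(V_{i−1} + V_i ∩ V'_{j−1}))`). -/
def matXX (n d : ℕ) (F : Type) [Field F]
    (V V' : Fin (2*n+1+1) → Submodule F (Fin (2*d+1) → F)) :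
    Matrix (Fin (2*n+1)) (Fin (2*n+1)) ℕ :=
  fun i j => finrank F ↥(V i.castSucc ⊔ V i.succ ⊓ V' j.succ)
    - finrank F ↥(V i.castSucc ⊔ V i.succ ⊓ V' j.castSucc)

/-- The `N×D` matrix associated to a pair consisting of an `N`-step flag and a
complete flag:
`b_{ij} = dim (V_{i−1} + V_i ∩ F_j) − dim (V_{i−1} + V_i ∩ F_{j−1})`. -/
def matXY (n d : ℕ) (F : Type) [Field F]
    (V : Fin (2*n+1+1) → Submodule F (Fin (2*d+1) → F))
    (Fl : Fin (2*d+1+1) → Submodule F (Fin (2*d+1) → F)) :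
    Matrix (Fin (2*n+1)) (Fin (2*d+1)) ℕ :=
  fun i j => finrank F ↥(V i.castSucc ⊔ V i.succ ⊓ Fl j.succ)
    - finrank F ↥(V i.castSucc ⊔ V i.succ ⊓ Fl j.castSucc)

section Congruence

variable {F : Type} [Field F]

theorem exists_mul_sq_add_mul_sq_eq_one [Fintype F] (hodd : Odd (Fintype.card F)) {a b : F}
    (ha : a ≠ 0) (hb : b ≠ 0) : ∃ x y : F, a * x ^ 2 + b * y ^ 2 = 1 := by
  classical
  have hg : (Polynomial.C b * Polynomial.X ^ 2 - Polynomial.C 1 : Polynomial F).degree = 2 := by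
    rw [Polynomial.degree_sub_C] <;> rw [Polynomial.degree_C_mul_X_pow 2 hb] <;> norm_num
  obtain ⟨x, y, h⟩ := FiniteField.exists_root_sum_quadratic
    (f := Polynomial.C a * Polynomial.X ^ 2) (Polynomial.degree_C_mul_X_pow 2 ha) hg
    (Nat.odd_iff.mp hodd)
  refine ⟨x, y, ?_⟩
  simp at h
  linear_combination h

theorem two_ne_zero_of_odd_card [Fintype F] (hodd : Odd (Fintype.card F)) : (2 : F) ≠ 0 := by
  apply Ring.two_ne_zero
  rw [Ne, FiniteField.even_card_iff_char_two, Nat.odd_iff.mp hodd]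
  norm_num

/-- An orthogonal family can be modified so that its norms are one on a prescribed set of indices,
provided one index is left free. -/
theorem exists_orthogonal_family_eq_one [Fintype F] (hodd : Odd (Fintype.card F))
    {M : Type} [AddCommGroup M] [Module F M] (B : M →ₗ[F] M →ₗ[F] F)
    {ι : Type} [DecidableEq ι] (i₀ : ι) (s : Finset ι) (hs : i₀ ∉ s) (v : ι → M) (w : ι → F)
    (hw : ∀ i, w i ≠ 0) (hv : ∀ i j, B (v i) (v j) = if i = j then w i else 0) :
    ∃ (v' : ι → M) (w' : ι → F), (∀ i, w' i ≠ 0) ∧ (∀ i ∈ s, w' i = 1) ∧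
      ∀ i j, B (v' i) (v' j) = if i = j then w' i else 0 := by
  induction s using Finset.induction_on with
  | empty => exact ⟨v, w, hw, by simp, hv⟩
  | insert i s his ih =>
    obtain ⟨v', w', hw', h1, hv'⟩ := ih (fun h => hs (Finset.mem_insert_of_mem h))
    have hi : i ≠ i₀ := fun h => hs (h ▸ Finset.mem_insert_self _ _)
    obtain ⟨x, y, hxy⟩ := exists_mul_sq_add_mul_sq_eq_one hodd (hw' i) (hw' i₀)
    refine ⟨fun j => if j = i then x • v' i + y • v' i₀ else
        if j = i₀ then (-(w' i₀ * y)) • v' i + (w' i * x) • v' i₀ else v' j,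
      fun j => if j = i then 1 else if j = i₀ then w' i * w' i₀ else w' j, ?_, ?_, ?_⟩
    · intro j
      dsimp only
      split_ifs
      · exact one_ne_zero
      · exact mul_ne_zero (hw' _) (hw' _)
      · exact hw' j
    · intro j hj
      rcases Finset.mem_insert.mp hj with rfl | hj
      · simp
      · have : j ≠ i₀ := fun h => hs (h ▸ Finset.mem_insert_of_mem hj)
        simp [this, h1 j hj]
    · intro j k
      have hi' : i₀ ≠ i := hi.symm
      have key : ∀ k, k ≠ i → k ≠ i₀ → i ≠ k ∧ i₀ ≠ k := fun k h h' => ⟨h.symm, h'.symm⟩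
      rcases eq_or_ne j i with rfl | hji
      · rcases eq_or_ne k j with rfl | hki
        · simp [hv', hi, hi']
          linear_combination hxy
        · rcases eq_or_ne k i₀ with rfl | hk0
          · simp [hv', hi, hi']
            ring
          · simp [hv', hki, hk0, key k hki hk0]
      · rcases eq_or_ne j i₀ with rfl | hj0
        · rcases eq_or_ne k i with rfl | hki
          · simp [hv', hi, hi']
            ring
          · rcases eq_or_ne k j with rfl | hk0
            · simp [hv', hi, hi']
              linear_combination w' i * w' k * hxy
            · simp [hv', hki, hk0, hi', key k hki hk0]
        · rcases eq_or_ne k i with rfl | hki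
          · simp [hv', hji, hj0]
          · rcases eq_or_ne k i₀ with rfl | hk0
            · simp [hv', hji, hj0, hi']
            · simp [hv', hji, hj0, hki, hk0]

/-- Two matrices are congruent when they are Gram matrices of the same form in two bases. -/
def MatCongr {ι : Type} [Fintype ι] [DecidableEq ι] (S T : Matrix ι ι F) : Prop :=
  ∃ P : Matrix ι ι F, P.det ≠ 0 ∧ P.transpose * S * P = T

namespace MatCongr

variable {ι : Type} [Fintype ι] [DecidableEq ι] {S T U : Matrix ι ι F}

theorem trans (h : MatCongr S T) (h' : MatCongr T U) : MatCongr S U := by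
  obtain ⟨P, hP, rfl⟩ := h
  obtain ⟨R, hR, rfl⟩ := h'
  exact ⟨P * R, by simp [hP, hR], by simp [Matrix.mul_assoc]⟩

theorem symm (h : MatCongr S T) : MatCongr T S := by
  obtain ⟨P, hP, rfl⟩ := h
  have hu : IsUnit P.det := hP.isUnit
  refine ⟨P⁻¹, ?_, ?_⟩
  · rw [Matrix.det_nonsing_inv]
    simpa using hP
  · rw [Matrix.transpose_nonsing_inv]
    have hu' : IsUnit P.transpose.det := by simpa using hu
    simp only [Matrix.mul_assoc, Matrix.mul_nonsing_inv P hu, Matrix.mul_one]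
    rw [← Matrix.mul_assoc, Matrix.nonsing_inv_mul _ hu', Matrix.one_mul]

theorem det_eq (h : MatCongr S T) : ∃ c : F, c ≠ 0 ∧ T.det = c ^ 2 * S.det := by
  obtain ⟨P, hP, rfl⟩ := h
  exact ⟨P.det, hP, by simp; ring⟩

theorem of_gram (hT : T.det ≠ 0) (v : ι → ι → F)
    (hv : ∀ i j, Matrix.toLinearMap₂' F S (v i) (v j) = T i j) : MatCongr S T := by
  have h : (Matrix.of v).transpose.transpose * S * (Matrix.of v).transpose = T := by
    ext i j
    rw [← hv, Matrix.toLinearMap₂'_apply']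
    simp only [Matrix.transpose_transpose, Matrix.mul_assoc]
    rfl
  refine ⟨(Matrix.of v).transpose, fun h0 => hT ?_, h⟩
  rw [← h, Matrix.det_mul, h0, mul_zero]

end MatCongr

variable {ι : Type} [Fintype ι] [DecidableEq ι]

theorem exists_matCongr_diagonal [Fintype F] (hodd : Odd (Fintype.card F)) (i₀ : ι)
    {S : Matrix ι ι F} (hS : S.IsSymm) (hdet : S.det ≠ 0) :
    ∃ δ : F, δ ≠ 0 ∧ MatCongr S (Matrix.diagonal (Function.update 1 i₀ δ)) := by
  let _ : Invertible (2 : F) := invertibleOfNonzero (two_ne_zero_of_odd_card hodd)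
  set B : LinearMap.BilinForm F (ι → F) := Matrix.toLinearMap₂' F S with hB
  have hsymm : LinearMap.IsSymm B := ⟨fun x y => by
    simp only [hB, Matrix.toLinearMap₂'_apply']
    rw [Matrix.dotProduct_mulVec, dotProduct_comm, ← Matrix.mulVec_transpose, hS.eq,
      RingHom.id_apply]⟩
  obtain ⟨v₀, hv₀⟩ := LinearMap.BilinForm.exists_orthogonal_basis hsymm
  have hcard : Fintype.card (Fin (finrank F (ι → F))) = Fintype.card ι := by simp
  let v := v₀.reindex (Fintype.equivOfCardEq hcard)
  have hv : ∀ i j, B (v i) (v j) = if i = j then B (v i) (v i) else 0 := by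
    intro i j
    split_ifs with h
    · rw [h]
    · simp only [v, Basis.reindex_apply]
      exact hv₀ (fun h' => h (by simpa using h'))
  have hw : ∀ i, B (v i) (v i) ≠ 0 := by
    intro i h0
    have hz : ∀ y, B (v i) y = 0 := by
      have : B (v i) = 0 := v.ext fun j => by
        rw [hv]; simp only [h0]; simp
      simp [this]
    have : v i = 0 := by
      apply Matrix.eq_zero_of_vecMul_eq_zero hdet
      refine dotProduct_eq_zero _ fun y => ?_
      rw [← Matrix.dotProduct_mulVec, ← Matrix.toLinearMap₂'_apply']
      exact hz y
    exact v.ne_zero i this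
  obtain ⟨v', w', hw', h1, hv'⟩ := exists_orthogonal_family_eq_one hodd B i₀
    (Finset.univ.erase i₀) (by simp) v _ hw hv
  refine ⟨w' i₀, hw' i₀, ?_⟩
  have he : Function.update (1 : ι → F) i₀ (w' i₀) = w' := by
    ext i
    by_cases h : i = i₀
    · subst h; simp
    · simp [h, h1]
  rw [he]
  refine MatCongr.of_gram ?_ v' ?_
  · simpa [Matrix.det_diagonal, Finset.prod_ne_zero_iff] using hw'
  · intro i j
    rw [Matrix.diagonal_apply, ← hv']

/-- Over a finite field of odd order, nondegenerate symmetric matrices are classified up to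
congruence by their size and their discriminant. -/
theorem matCongr_of_det_eq [Fintype F] (hodd : Odd (Fintype.card F))
    {S T : Matrix ι ι F} (hS : S.IsSymm) (hT : T.IsSymm) (hdet : S.det ≠ 0) {c : F} (hc : c ≠ 0)
    (h : T.det = c ^ 2 * S.det) : MatCongr S T := by
  rcases isEmpty_or_nonempty ι with hι | ⟨⟨i₀⟩⟩
  · exact ⟨1, by simp, Subsingleton.elim _ _⟩
  have hdetT : T.det ≠ 0 := by
    rw [h]; exact mul_ne_zero (pow_ne_zero _ hc) hdet
  obtain ⟨δ, hδ, h₁⟩ := exists_matCongr_diagonal hodd i₀ hS hdet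
  obtain ⟨ε, hε, h₂⟩ := exists_matCongr_diagonal hodd i₀ hT hdetT
  obtain ⟨a, ha, h₃⟩ := h₁.det_eq
  obtain ⟨b, hb, h₄⟩ := h₂.det_eq
  have hd : ∀ x : F, (Matrix.diagonal (Function.update (1 : ι → F) i₀ x)).det = x := by
    intro x
    rw [Matrix.det_diagonal, Finset.prod_update_of_mem (Finset.mem_univ _)]
    simp
  rw [hd] at h₃ h₄
  refine h₁.trans (MatCongr.trans ?_ h₂.symm)
  set r := b * c / a with hr
  have hr0 : r ≠ 0 := div_ne_zero (mul_ne_zero hb hc) ha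
  refine ⟨Matrix.diagonal (Function.update 1 i₀ r), by rw [hd]; exact hr0, ?_⟩
  rw [Matrix.diagonal_transpose, Matrix.diagonal_mul_diagonal, Matrix.diagonal_mul_diagonal]
  congr 1
  ext i
  by_cases hi : i = i₀
  · subst hi
    simp only [Function.update_self]
    rw [h₄, h, h₃, hr]
    field_simp
  · simp [hi]

end Congruence

section Flags

variable {F M : Type} [Field F] [AddCommGroup M] [Module F M]

theorem mem_orthB {Q : M →ₗ[F] M →ₗ[F] F} {W : Submodule F M} {u : M} :
    u ∈ orthB Q W ↔ ∀ w ∈ W, Q u w = 0 := Iff.rfl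

theorem orthB_sup (Q : M →ₗ[F] M →ₗ[F] F) (W W' : Submodule F M) :
    orthB Q (W ⊔ W') = orthB Q W ⊓ orthB Q W' := by
  ext u
  simp only [Submodule.mem_inf, mem_orthB]
  refine ⟨fun h => ⟨fun w hw => h w (Submodule.mem_sup_left hw),
    fun w hw => h w (Submodule.mem_sup_right hw)⟩, ?_⟩
  rintro ⟨h, h'⟩ w hw
  obtain ⟨a, ha, b, hb, rfl⟩ := Submodule.mem_sup.mp hw
  rw [map_add, h a ha, h' b hb, add_zero]

theorem orthB_orthB [FiniteDimensional F M] {Q : M →ₗ[F] M →ₗ[F] F} (hsymm : ∀ u v, Q u v = Q v u)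
    (hnd : ∀ u, (∀ v, Q u v = 0) → u = 0) (W : Submodule F M) : orthB Q (orthB Q W) = W := by
  have h : ∀ U : Submodule F M, orthB Q U = LinearMap.BilinForm.orthogonal Q U := fun U => by
    ext u
    simp only [mem_orthB, LinearMap.BilinForm.mem_orthogonal_iff]
    exact forall₂_congr fun w _ => by rw [hsymm]
  rw [h, h]
  refine LinearMap.BilinForm.orthogonal_orthogonal ⟨hnd, fun v hv => hnd v fun u => ?_⟩ ?_ W
  · rw [hsymm, hv]
  · intro u v huv
    rw [hsymm, huv]

/-- A flag of odd length `2 n + 1` which is equal to its own orthogonal flag. -/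
structure IsSelfDualFlag {n : ℕ} (Q : M →ₗ[F] M →ₗ[F] F)
    (V : Fin (2 * n + 1 + 1) → Submodule F M) : Prop where
  mono : Monotone V
  zero : V 0 = ⊥
  last : V (Fin.last (2 * n + 1)) = ⊤
  orth : ∀ i, V i = orthB Q (V i.rev)

/-- The middle step of a flag of odd length. -/
def midStep (n : ℕ) : Fin (2 * n + 1) := ⟨n, by omega⟩

theorem rev_midStep (n : ℕ) : (midStep n).rev = midStep n := by
  ext; simp [midStep, Fin.val_rev]; omega

namespace IsSelfDualFlag

variable {n : ℕ} {Q : M →ₗ[F] M →ₗ[F] F} {V : Fin (2 * n + 1 + 1) → Submodule F M}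

theorem apply_eq_zero (hV : IsSelfDualFlag Q V) {k l : Fin (2 * n + 1 + 1)} (hkl : l ≤ k.rev)
    {x y : M} (hx : x ∈ V k) (hy : y ∈ V l) : Q x y = 0 := by
  rw [hV.orth k] at hx
  exact hx y (hV.mono hkl hy)

theorem apply_self (hV : IsSelfDualFlag Q V) {k : Fin (2 * n + 1)} (hk : k < midStep n)
    {x : M} (hx : x ∈ V k.succ) : Q x x = 0 := by
  refine hV.apply_eq_zero (k := k.succ) ?_ hx hx
  simp only [Fin.lt_def, Fin.le_def, Fin.val_rev, Fin.val_succ, midStep] at *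
  omega

theorem succ_le_rev_succ (hV : IsSelfDualFlag Q V) {k : Fin (2 * n + 1)} (hk : k ≤ midStep n) :
    V k.succ ≤ V k.rev.succ := by
  apply hV.mono
  simp only [Fin.le_def, Fin.val_rev, Fin.val_succ, midStep] at *
  omega

end IsSelfDualFlag

/-- A pair of steps is negative if it precedes the pair of middle steps lexicographically. For a
pair other than the middle one, exactly one of the pair and its reversal is negative. -/
def IsNeg {n m : ℕ} (p : Fin (2 * n + 1) × Fin (2 * m + 1)) : Prop :=
  p.1 < midStep n ∨ p.1 = midStep n ∧ p.2 < midStep m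

/-- A family of mutually orthogonal hyperbolic pairs whose members lie in prescribed
intersections of steps of two self-dual flags. -/
structure HyperbolicFamily {n m : ℕ} (Q : M →ₗ[F] M →ₗ[F] F)
    (V : Fin (2 * n + 1 + 1) → Submodule F M) (V' : Fin (2 * m + 1 + 1) → Submodule F M)
    (H : Type) where
  step : H → Fin (2 * n + 1) × Fin (2 * m + 1)
  isNeg : ∀ h, IsNeg (step h)
  e : H → M
  f : H → M
  e_mem : ∀ h, e h ∈ V (step h).1.succ ⊓ V' (step h).2.succ
  f_mem : ∀ h, f h ∈ V (step h).1.rev.succ ⊓ V' (step h).2.rev.succ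
  e_e : ∀ h h', Q (e h) (e h') = 0
  f_f : ∀ h h', Q (f h) (f h') = 0
  e_f_self : ∀ h, Q (e h) (f h) = 1
  e_f : ∀ h h', h ≠ h' → Q (e h) (f h') = 0

namespace HyperbolicFamily

variable {n m : ℕ} {Q : M →ₗ[F] M →ₗ[F] F} {V : Fin (2 * n + 1 + 1) → Submodule F M}
  {V' : Fin (2 * m + 1 + 1) → Submodule F M} {H : Type}

/-- The orthogonal complement of the span of a hyperbolic family. -/
def compl (E : HyperbolicFamily Q V V' H) : Submodule F M :=
  orthB Q (Submodule.span F (Set.range E.e ∪ Set.range E.f))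

theorem mem_compl (E : HyperbolicFamily Q V V' H) {x : M} :
    x ∈ E.compl ↔ ∀ h, Q x (E.e h) = 0 ∧ Q x (E.f h) = 0 := by
  constructor
  · intro hx h
    exact ⟨hx _ (Submodule.subset_span (Or.inl ⟨h, rfl⟩)),
      hx _ (Submodule.subset_span (Or.inr ⟨h, rfl⟩))⟩
  · intro hx
    have : Submodule.span F (Set.range E.e ∪ Set.range E.f) ≤ LinearMap.ker (Q x) := by
      rw [Submodule.span_le]
      rintro _ (⟨h, rfl⟩ | ⟨h, rfl⟩)
      · exact (hx h).1
      · exact (hx h).2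
    exact fun w hw => this hw

variable [Fintype H]

/-- The component of a vector along a hyperbolic family. -/
def proj (E : HyperbolicFamily Q V V' H) (x : M) : M :=
  ∑ h, (Q x (E.f h) • E.e h + Q x (E.e h) • E.f h)

theorem sub_proj_mem (hsymm : ∀ u v, Q u v = Q v u) (E : HyperbolicFamily Q V V' H) (x : M) :
    x - E.proj x ∈ E.compl := by
  classical
  rw [E.mem_compl]
  intro h
  have hfe : ∀ h h', Q (E.f h') (E.e h) = if h' = h then 1 else 0 := by
    intro h h'
    rw [hsymm]
    split_ifs with hh
    · rw [hh, E.e_f_self]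
    · exact E.e_f _ _ (Ne.symm hh)
  have hef : ∀ h h', Q (E.e h') (E.f h) = if h' = h then 1 else 0 := by
    intro h h'
    rw [hsymm, hfe]
    simp only [eq_comm]
  simp [proj, E.e_e, E.f_f, hfe, hef]

theorem proj_mem_left (hV : IsSelfDualFlag Q V)
    (E : HyperbolicFamily Q V V' H) {k : Fin (2 * n + 1 + 1)}
    {x : M} (hx : x ∈ V k) : E.proj x ∈ V k := by
  refine Submodule.sum_mem _ fun h _ => Submodule.add_mem _ ?_ ?_
  · rcases le_or_gt (E.step h).1.succ k with hk | hk
    · exact Submodule.smul_mem _ _ (hV.mono hk (E.e_mem h).1)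
    · rw [hV.apply_eq_zero ?_ hx (E.f_mem h).1, zero_smul]
      · exact Submodule.zero_mem _
      · simp only [Fin.lt_def, Fin.le_def, Fin.val_rev, Fin.val_succ] at *
        omega
  · rcases le_or_gt (E.step h).1.rev.succ k with hk | hk
    · exact Submodule.smul_mem _ _ (hV.mono hk (E.f_mem h).1)
    · rw [hV.apply_eq_zero ?_ hx (E.e_mem h).1, zero_smul]
      · exact Submodule.zero_mem _
      · simp only [Fin.lt_def, Fin.le_def, Fin.val_rev, Fin.val_succ] at *
        omega

theorem proj_mem_right (hV' : IsSelfDualFlag Q V')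
    (E : HyperbolicFamily Q V V' H) {k : Fin (2 * m + 1 + 1)}
    {x : M} (hx : x ∈ V' k) : E.proj x ∈ V' k := by
  refine Submodule.sum_mem _ fun h _ => Submodule.add_mem _ ?_ ?_
  · rcases le_or_gt (E.step h).2.succ k with hk | hk
    · exact Submodule.smul_mem _ _ (hV'.mono hk (E.e_mem h).2)
    · rw [hV'.apply_eq_zero ?_ hx (E.f_mem h).2, zero_smul]
      · exact Submodule.zero_mem _
      · simp only [Fin.lt_def, Fin.le_def, Fin.val_rev, Fin.val_succ] at *
        omega
  · rcases le_or_gt (E.step h).2.rev.succ k with hk | hk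
    · exact Submodule.smul_mem _ _ (hV'.mono hk (E.f_mem h).2)
    · rw [hV'.apply_eq_zero ?_ hx (E.e_mem h).2, zero_smul]
      · exact Submodule.zero_mem _
      · simp only [Fin.lt_def, Fin.le_def, Fin.val_rev, Fin.val_succ] at *
        omega

theorem apply_proj (E : HyperbolicFamily Q V V' H) {x : M} (hx : x ∈ E.compl) (y : M) :
    Q x (E.proj y) = 0 := by
  simp only [proj, map_sum, map_add, map_smul]
  refine Finset.sum_eq_zero fun h _ => ?_
  rw [(E.mem_compl.mp hx h).1, (E.mem_compl.mp hx h).2]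
  simp

theorem compl_le_orthB (hsymm : ∀ u v, Q u v = Q v u) (E : HyperbolicFamily Q V V' H)
    {W : Submodule F M} (hW : ∀ x ∈ W, E.proj x ∈ W) (h : E.compl ⊓ W = ⊥) :
    E.compl ≤ orthB Q W := by
  intro x hx w hw
  have h0 : w - E.proj w ∈ E.compl ⊓ W :=
    ⟨E.sub_proj_mem hsymm w, Submodule.sub_mem _ hw (hW w hw)⟩
  rw [h, Submodule.mem_bot, sub_eq_zero] at h0
  rw [h0, E.apply_proj hx]

theorem linearIndependent_e (E : HyperbolicFamily Q V V' H) :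
    LinearIndependent F E.e := by
  rw [Fintype.linearIndependent_iff]
  intro g hg h
  have := congrArg (fun x => Q x (E.f h)) hg
  simp only [map_sum, map_smul, LinearMap.sum_apply, LinearMap.smul_apply, map_zero,
    LinearMap.zero_apply, smul_eq_mul] at this
  rw [Finset.sum_eq_single h, E.e_f_self, mul_one] at this
  · exact this
  · intro b _ hb
    rw [E.e_f _ _ hb, mul_zero]
  · simp

/-- A non-zero vector of a negative pair of steps orthogonal to a hyperbolic family, minimal among
such, is the first member of an additional hyperbolic pair. -/
theorem exists_extension [FiniteDimensional F M] (h2 : (2 : F) ≠ 0)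
    (hsymm : ∀ u v, Q u v = Q v u) (hnd : ∀ u, (∀ v, Q u v = 0) → u = 0)
    (hV : IsSelfDualFlag Q V) (hV' : IsSelfDualFlag Q V') (E : HyperbolicFamily Q V V' H)
    {i : Fin (2 * n + 1)} {j : Fin (2 * m + 1)} (hij : IsNeg (i, j))
    (hi : E.compl ⊓ V i.castSucc = ⊥) (hj : E.compl ⊓ V i.succ ⊓ V' j.castSucc = ⊥)
    (hne : E.compl ⊓ V i.succ ⊓ V' j.succ ≠ ⊥) :
    Nonempty (HyperbolicFamily Q V V' (Option H)) := by
  obtain ⟨e, ⟨⟨heR, hei⟩, hej⟩, he0⟩ := Submodule.exists_mem_ne_zero_of_ne_bot hne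
  have hex : ∃ f₀ ∈ V i.rev.succ ⊓ V' j.rev.succ, Q e f₀ ≠ 0 := by
    by_contra! hcon
    have hmem : e ∈ orthB Q (V i.rev.succ ⊓ V' j.rev.succ) := hcon
    have h₁ : V i.rev.succ = orthB Q (V i.castSucc) := by
      rw [hV.orth, Fin.rev_succ, Fin.rev_rev]
    have h₂ : V' j.rev.succ = orthB Q (V' j.castSucc) := by
      rw [hV'.orth, Fin.rev_succ, Fin.rev_rev]
    rw [h₁, h₂, ← orthB_sup, orthB_orthB hsymm hnd] at hmem
    obtain ⟨a, ha, b, hb, hab⟩ := Submodule.mem_sup.mp hmem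
    have hπ : E.proj e = 0 := by
      refine Finset.sum_eq_zero fun h _ => ?_
      rw [((E.mem_compl).mp heR h).1, ((E.mem_compl).mp heR h).2, zero_smul, zero_smul, add_zero]
    have hsum : (a - E.proj a) + (b - E.proj b) = e := by
      have : E.proj a + E.proj b = E.proj e := by
        rw [← hab]
        simp only [proj, ← Finset.sum_add_distrib]
        refine Finset.sum_congr rfl fun h _ => ?_
        simp only [map_add, LinearMap.add_apply, add_smul]
        abel
      rw [hπ] at this
      rw [← hab, ← sub_eq_zero]
      rw [← neg_eq_zero, ← this]
      abel
    have ha' : a - E.proj a = 0 := by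
      have : a - E.proj a ∈ E.compl ⊓ V i.castSucc :=
        ⟨E.sub_proj_mem hsymm a, Submodule.sub_mem _ ha (E.proj_mem_left hV ha)⟩
      rwa [hi, Submodule.mem_bot] at this
    rw [ha', zero_add] at hsum
    have : e ∈ E.compl ⊓ V i.succ ⊓ V' j.castSucc :=
      ⟨⟨heR, hei⟩, hsum ▸ Submodule.sub_mem _ hb (E.proj_mem_right hV' hb)⟩
    rw [hj, Submodule.mem_bot] at this
    exact he0 this
  obtain ⟨f₀, ⟨hf₀i, hf₀j⟩, hf₀⟩ := hex
  have hee : Q e e = 0 := by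
    rcases hij with hlt | ⟨-, hlt⟩
    · exact hV.apply_self hlt hei
    · exact hV'.apply_self hlt hej
  have hile : i ≤ midStep n := by
    rcases hij with hlt | ⟨h, -⟩
    · exact le_of_lt hlt
    · exact le_of_eq h
  set f₁ := f₀ - E.proj f₀ with hf₁
  have hef₁ : Q e f₁ ≠ 0 := by
    rwa [hf₁, map_sub, E.apply_proj heR, sub_zero]
  have hf₁R : f₁ ∈ E.compl := E.sub_proj_mem hsymm f₀
  have hf₁i : f₁ ∈ V i.rev.succ := Submodule.sub_mem _ hf₀i (E.proj_mem_left hV hf₀i)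
  have hf₁j : f₁ ∈ V' j.rev.succ := Submodule.sub_mem _ hf₀j (E.proj_mem_right hV' hf₀j)
  set f₂ := (Q e f₁)⁻¹ • f₁ with hf₂
  have hef₂ : Q e f₂ = 1 := by simp [hf₂, hef₁]
  have hf₂j : f₂ ∈ V' j.rev.succ := Submodule.smul_mem _ _ hf₁j
  set f := f₂ - (Q f₂ f₂ / 2) • e with hf
  have hfR : f ∈ E.compl :=
    Submodule.sub_mem _ (Submodule.smul_mem _ _ hf₁R) (Submodule.smul_mem _ _ heR)
  have hfi : f ∈ V i.rev.succ :=
    Submodule.sub_mem _ (Submodule.smul_mem _ _ hf₁i)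
      (Submodule.smul_mem _ _ (hV.succ_le_rev_succ hile hei))
  have hfj : f ∈ V' j.rev.succ := by
    refine Submodule.sub_mem _ hf₂j ?_
    rcases le_or_gt j (midStep m) with hjm | hjm
    · exact Submodule.smul_mem _ _ (hV'.succ_le_rev_succ hjm hej)
    · have : j.rev < midStep m := by
        simp only [Fin.lt_def, Fin.val_rev, midStep] at *
        omega
      rw [hV'.apply_self this hf₂j, zero_div, zero_smul]
      exact Submodule.zero_mem _
  have hef : Q e f = 1 := by simp [hf, hee, hef₂]
  have hff : Q f f = 0 := by
    simp only [hf, map_sub, map_smul, LinearMap.sub_apply, LinearMap.smul_apply, hee, hef₂,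
      hsymm f₂ e, smul_eq_mul]
    field_simp
    ring
  have hR : ∀ {x}, x ∈ E.compl → ∀ h, Q x (E.e h) = 0 ∧ Q x (E.f h) = 0 :=
    fun hx => E.mem_compl.mp hx
  have hR' : ∀ {x}, x ∈ E.compl → ∀ h, Q (E.e h) x = 0 ∧ Q (E.f h) x = 0 :=
    fun hx h => by rw [hsymm _ _, hsymm (E.f h)]; exact hR hx h
  refine ⟨{
    step := fun o => o.elim (i, j) E.step
    isNeg := ?_
    e := fun o => o.elim e E.e
    f := fun o => o.elim f E.f
    e_mem := ?_
    f_mem := ?_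
    e_e := ?_
    f_f := ?_
    e_f_self := ?_
    e_f := ?_ }⟩
  · rintro (_ | h)
    exacts [hij, E.isNeg h]
  · rintro (_ | h)
    exacts [⟨hei, hej⟩, E.e_mem h]
  · rintro (_ | h)
    exacts [⟨hfi, hfj⟩, E.f_mem h]
  · rintro (_ | h) (_ | h')
    exacts [hee, (hR heR h').1, (hR' heR h).1, E.e_e h h']
  · rintro (_ | h) (_ | h')
    exacts [hff, (hR hfR h').2, (hR' hfR h).2, E.f_f h h']
  · rintro (_ | h)
    exacts [hef, E.e_f_self h]
  · rintro (_ | h) (_ | h') hh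
    · exact absurd rfl hh
    · exact (hR heR h').2
    · exact (hR' hfR h).1
    · exact E.e_f h h' (fun h0 => hh (congrArg some h0))

end HyperbolicFamily

theorem exists_hyperbolicFamily [FiniteDimensional F M] (h2 : (2 : F) ≠ 0)
    {Q : M →ₗ[F] M →ₗ[F] F} (hsymm : ∀ u v, Q u v = Q v u)
    (hnd : ∀ u, (∀ v, Q u v = 0) → u = 0) {n m : ℕ}
    {V : Fin (2 * n + 1 + 1) → Submodule F M} {V' : Fin (2 * m + 1 + 1) → Submodule F M}
    (hV : IsSelfDualFlag Q V) (hV' : IsSelfDualFlag Q V') :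
    ∃ (H : Type) (_ : Fintype H) (E : HyperbolicFamily Q V V' H),
      E.compl ⊓ V (midStep n).castSucc = ⊥ ∧ E.compl ⊓ V' (midStep m).castSucc = ⊥ := by
  have hmax : ∃ (H : Type) (_ : Fintype H), Nonempty (HyperbolicFamily Q V V' H) ∧
      IsEmpty (HyperbolicFamily Q V V' (Option H)) := by
    by_contra! hcon
    have hall : ∀ r : ℕ, ∃ (H : Type) (_ : Fintype H), Fintype.card H = r ∧
        Nonempty (HyperbolicFamily Q V V' H) := by
      intro r
      induction r with
      | zero =>
        refine ⟨Empty, inferInstance, rfl, ⟨⟨nofun, nofun, nofun, nofun, nofun, nofun, nofun,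
          nofun, nofun, nofun⟩⟩⟩
      | succ r ih =>
        obtain ⟨H, _, hr, hH⟩ := ih
        exact ⟨Option H, inferInstance, by simp [hr], hcon H inferInstance hH⟩
    obtain ⟨H, _, hr, ⟨E⟩⟩ := hall (finrank F M + 1)
    have := (E.linearIndependent_e).fintype_card_le_finrank
    omega
  obtain ⟨H, hfin, ⟨E⟩, hE⟩ := hmax
  have hext : ∀ {i : Fin (2 * n + 1)} {j : Fin (2 * m + 1)}, IsNeg (i, j) →
      E.compl ⊓ V i.castSucc = ⊥ → E.compl ⊓ V i.succ ⊓ V' j.castSucc = ⊥ →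
      E.compl ⊓ V i.succ ⊓ V' j.succ = ⊥ := by
    intro i j hij hi hj
    by_contra hne
    obtain ⟨E'⟩ := E.exists_extension h2 hsymm hnd hV hV' hij hi hj hne
    exact hE.elim E'
  have hleft : ∀ k : Fin (2 * n + 1 + 1), k ≤ (midStep n).castSucc → E.compl ⊓ V k = ⊥ := by
    intro k
    induction k using Fin.induction with
    | zero => intro _; rw [hV.zero, inf_bot_eq]
    | succ i ih =>
      intro hi
      have hlt : i < midStep n := by
        simp only [Fin.lt_def, Fin.le_def, Fin.val_succ, Fin.val_castSucc] at *
        omega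
      have hi' := ih (Fin.castSucc_le_castSucc_iff.mpr hlt.le)
      have hj : ∀ l, E.compl ⊓ V i.succ ⊓ V' l = ⊥ := by
        intro l
        induction l using Fin.induction with
        | zero => rw [hV'.zero, inf_bot_eq]
        | succ j ihj => exact hext (Or.inl hlt) hi' ihj
      simpa [hV'.last] using hj (Fin.last _)
  have h1 := hleft _ le_rfl
  refine ⟨H, hfin, E, h1, ?_⟩
  have hright : ∀ l : Fin (2 * m + 1 + 1), l ≤ (midStep m).castSucc →
      E.compl ⊓ V (midStep n).succ ⊓ V' l = ⊥ := by
    intro l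
    induction l using Fin.induction with
    | zero => intro _; rw [hV'.zero, inf_bot_eq]
    | succ j ih =>
      intro hj
      have hlt : j < midStep m := by
        simp only [Fin.lt_def, Fin.le_def, Fin.val_succ, Fin.val_castSucc] at *
        omega
      exact hext (Or.inr ⟨rfl, hlt⟩) h1 (ih (Fin.castSucc_le_castSucc_iff.mpr hlt.le))
  have hle : E.compl ≤ V (midStep n).succ := by
    rw [hV.orth, Fin.rev_succ, rev_midStep]
    exact E.compl_le_orthB hsymm (fun _ => E.proj_mem_left hV) h1
  rw [← hright _ le_rfl, inf_eq_left.mpr hle]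

end Flags

section AdaptedBasis

variable {F M : Type} [Field F] [AddCommGroup M] [Module F M]

/-- The pair of reversed steps. -/
def revPair {n m : ℕ} (p : Fin (2 * n + 1) × Fin (2 * m + 1)) :
    Fin (2 * n + 1) × Fin (2 * m + 1) := (p.1.rev, p.2.rev)

/-- The pair of middle steps. -/
def midPair (n m : ℕ) : Fin (2 * n + 1) × Fin (2 * m + 1) := (midStep n, midStep m)

theorem revPair_revPair {n m : ℕ} (p : Fin (2 * n + 1) × Fin (2 * m + 1)) :
    revPair (revPair p) = p := by simp [revPair]

theorem revPair_midPair (n m : ℕ) : revPair (midPair n m) = midPair n m := by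
  simp [revPair, midPair, rev_midStep]

theorem IsNeg.not_isNeg_revPair {n m : ℕ} {p : Fin (2 * n + 1) × Fin (2 * m + 1)} (h : IsNeg p) :
    ¬ IsNeg (revPair p) := by
  simp only [IsNeg, revPair, midStep, Fin.lt_def, Fin.ext_iff, Fin.val_rev] at *
  omega

theorem not_isNeg_midPair (n m : ℕ) : ¬ IsNeg (midPair n m) := by
  simp [IsNeg, midPair]

theorem isNeg_trichotomy {n m : ℕ} (p : Fin (2 * n + 1) × Fin (2 * m + 1)) :
    IsNeg p ∨ IsNeg (revPair p) ∨ p = midPair n m := by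
  obtain ⟨i, j⟩ := p
  simp only [IsNeg, revPair, midPair, midStep, Fin.lt_def, Fin.ext_iff, Fin.val_rev,
    Prod.mk.injEq] at *
  omega

/-- The steps attached to the members of a family of hyperbolic pairs and of vectors in the middle
steps. -/
def pairSteps {n m : ℕ} {H K : Type} (c : H → Fin (2 * n + 1) × Fin (2 * m + 1)) :
    (H ⊕ H) ⊕ K → Fin (2 * n + 1) × Fin (2 * m + 1) :=
  Sum.elim (Sum.elim c (fun h => revPair (c h))) (fun _ => midPair n m)

theorem pairSteps_swap {n m : ℕ} {H K : Type} (c : H → Fin (2 * n + 1) × Fin (2 * m + 1))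
    (s : (H ⊕ H) ⊕ K) : pairSteps c (Sum.map Sum.swap id s) = revPair (pairSteps c s) := by
  rcases s with (h | h) | k
  · rfl
  · exact (revPair_revPair _).symm
  · exact (revPair_midPair n m).symm

/-- A basis is adapted to two flags if every step of either flag is spanned by basis vectors, as
recorded by the function `c`. -/
structure IsAdapted {ι : Type} {N N' : ℕ} (u : Basis ι F M) (c : ι → Fin N × Fin N')
    (V : Fin (N + 1) → Submodule F M) (V' : Fin (N' + 1) → Submodule F M) : Prop where
  left : ∀ k, V k = Submodule.span F (u '' {s | (c s).1.castSucc < k})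
  right : ∀ k, V' k = Submodule.span F (u '' {s | (c s).2.castSucc < k})

/-- The dimensions of the successive quotients of the flags induced by the second flag on the
successive quotients of the first. -/
def relDim {N N' : ℕ} (V : Fin (N + 1) → Submodule F M) (V' : Fin (N' + 1) → Submodule F M)
    (i : Fin N) (j : Fin N') : ℕ :=
  finrank F ↥(V i.castSucc ⊔ V i.succ ⊓ V' j.succ)
    - finrank F ↥(V i.castSucc ⊔ V i.succ ⊓ V' j.castSucc)

theorem finrank_span_image {ι : Type} [Fintype ι] (u : Basis ι F M) (s : Set ι)
    [DecidablePred (· ∈ s)] :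
    finrank F ↥(Submodule.span F (u '' s)) = (Finset.univ.filter (· ∈ s)).card := by
  rw [Set.image_eq_range, finrank_span_eq_card (b := fun x : s => u x)
    (u.linearIndependent.comp _ Subtype.val_injective), Fintype.card_subtype]

theorem span_image_inf {ι : Type} (u : Basis ι F M) (s t : Set ι) :
    Submodule.span F (u '' s) ⊓ Submodule.span F (u '' t) = Submodule.span F (u '' (s ∩ t)) := by
  ext x
  simp [Submodule.mem_inf, Basis.mem_span_image]

theorem span_image_sup {ι : Type} (u : Basis ι F M) (s t : Set ι) :
    Submodule.span F (u '' s) ⊔ Submodule.span F (u '' t) = Submodule.span F (u '' (s ∪ t)) := by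
  rw [Set.image_union, Submodule.span_union]

namespace IsAdapted

variable {ι : Type} [Fintype ι] {N N' : ℕ} {u : Basis ι F M} {c : ι → Fin N × Fin N'}
  {V : Fin (N + 1) → Submodule F M} {V' : Fin (N' + 1) → Submodule F M}

theorem relDim_eq (h : IsAdapted u c V V') (i : Fin N) (j : Fin N') :
    relDim V V' i j = (Finset.univ.filter (fun s => c s = (i, j))).card := by
  classical
  have hk : ∀ k, V i.castSucc ⊔ V i.succ ⊓ V' k = Submodule.span F
      (u '' ({s | (c s).1.castSucc < i.castSucc} ∪
        {s | (c s).1.castSucc < i.succ} ∩ {s | (c s).2.castSucc < k})) := by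
    intro k
    rw [h.left, h.left, h.right, span_image_inf, span_image_sup]
  rw [relDim, hk, hk, finrank_span_image, finrank_span_image, ← Finset.card_sdiff_of_subset]
  · congr 1
    ext s
    simp only [Finset.mem_sdiff, Finset.mem_filter, Finset.mem_univ, true_and, Set.mem_union,
      Set.mem_inter_iff, Set.mem_ofPred_eq, Prod.ext_iff, Fin.lt_def, Fin.ext_iff, Fin.val_succ,
      Fin.val_castSucc]
    omega
  · intro s
    simp only [Finset.mem_filter, Finset.mem_univ, true_and, Set.mem_union, Set.mem_inter_iff,
      Set.mem_ofPred_eq, Fin.lt_def, Fin.val_succ, Fin.val_castSucc]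
    omega

theorem sum_relDim_add (h : IsAdapted u c V V') (j : Fin N') :
    ∑ i, relDim V V' i j + finrank F (V' j.castSucc) = finrank F (V' j.succ) := by
  classical
  have hs : ∑ i, relDim V V' i j = (Finset.univ.filter (fun s => (c s).2 = j)).card := by
    rw [Finset.card_eq_sum_card_fiberwise (f := fun s => (c s).1) (t := Finset.univ)
      (fun _ _ => Finset.mem_univ _)]
    refine Finset.sum_congr rfl fun i _ => ?_
    rw [h.relDim_eq, Finset.filter_filter]
    congr 1
    ext s
    simp [Prod.ext_iff, and_comm]
  rw [hs, h.right, h.right, finrank_span_image, finrank_span_image,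
    ← Finset.card_union_of_disjoint]
  · congr 1
    ext s
    simp only [Finset.mem_filter, Finset.mem_univ, true_and, Finset.mem_union, Set.mem_ofPred_eq,
      Fin.lt_def, Fin.ext_iff, Fin.val_succ, Fin.val_castSucc]
    omega
  · rw [Finset.disjoint_filter]
    rintro s - rfl
    simp

theorem sum_sum_relDim (h : IsAdapted u c V V') :
    ∑ i, ∑ j, relDim V V' i j = Fintype.card ι := by
  classical
  rw [← Fintype.sum_prod_type', ← Finset.card_univ,
    Finset.card_eq_sum_card_fiberwise (f := c) (t := Finset.univ) (fun _ _ => Finset.mem_univ _)]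
  exact Finset.sum_congr rfl fun p _ => h.relDim_eq p.1 p.2

end IsAdapted

theorem card_pairSteps_fiber {n m : ℕ} {H K : Type} [Fintype H] [Fintype K]
    (c : H → Fin (2 * n + 1) × Fin (2 * m + 1)) (p : Fin (2 * n + 1) × Fin (2 * m + 1)) :
    (Finset.univ.filter (fun s : (H ⊕ H) ⊕ K => pairSteps c s = p)).card =
      (Finset.univ.filter (fun h => c h = p)).card +
      (Finset.univ.filter (fun h => c h = revPair p)).card +
      if p = midPair n m then Fintype.card K else 0 := by
  have hr : ∀ h, revPair (c h) = p ↔ c h = revPair p := fun h =>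
    ⟨fun e => by rw [← e, revPair_revPair], fun e => by rw [e, revPair_revPair]⟩
  have hk : (∑ _k : K, if midPair n m = p then 1 else 0) =
      if p = midPair n m then Fintype.card K else 0 := by
    simp only [eq_comm (a := p)]
    split_ifs <;> simp
  rw [Finset.card_filter, Fintype.sum_sum_type, Fintype.sum_sum_type, Finset.card_filter,
    Finset.card_filter, ← hk]
  simp only [pairSteps, Sum.elim_inl, Sum.elim_inr, hr]
  congr!

theorem card_fiber_of_not_isNeg {n m : ℕ} {H : Type} [Fintype H]
    {c : H → Fin (2 * n + 1) × Fin (2 * m + 1)} (hc : ∀ h, IsNeg (c h))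
    {p : Fin (2 * n + 1) × Fin (2 * m + 1)} (hp : ¬ IsNeg p) :
    (Finset.univ.filter (fun h => c h = p)).card = 0 := by
  rw [Finset.card_eq_zero, Finset.filter_eq_empty_iff]
  rintro h - rfl
  exact hp (hc h)

/-- The Gram matrix of a family of orthogonal hyperbolic pairs. -/
def hyperbolicGram (F H : Type) [Field F] [DecidableEq H] : Matrix (H ⊕ H) (H ⊕ H) F :=
  Matrix.fromBlocks 0 1 1 0

theorem det_hyperbolicGram_ne_zero (F H : Type) [Field F] [Fintype H] [DecidableEq H] :
    (hyperbolicGram F H).det ≠ 0 := by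
  have h : hyperbolicGram F H * hyperbolicGram F H = 1 := by
    simp [hyperbolicGram, Matrix.fromBlocks_multiply]
  exact (Matrix.isUnit_det_of_right_inverse h).ne_zero

theorem HyperbolicFamily.exists_adapted_basis [FiniteDimensional F M]
    {Q : M →ₗ[F] M →ₗ[F] F} (hsymm : ∀ u v, Q u v = Q v u) {n m : ℕ}
    {V : Fin (2 * n + 1 + 1) → Submodule F M} {V' : Fin (2 * m + 1 + 1) → Submodule F M}
    (hV : IsSelfDualFlag Q V) (hV' : IsSelfDualFlag Q V') {H : Type} [Fintype H] [DecidableEq H]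
    (E : HyperbolicFamily Q V V' H) (h₁ : E.compl ⊓ V (midStep n).castSucc = ⊥)
    (h₂ : E.compl ⊓ V' (midStep m).castSucc = ⊥) :
    ∃ (K : Type) (_ : Fintype K) (u : Basis ((H ⊕ H) ⊕ K) F M) (S : Matrix K K F),
      IsAdapted u (pairSteps E.step) V V' ∧
      ∀ s t, Q (u s) (u t) = Matrix.fromBlocks (hyperbolicGram F H) 0 0 S s t := by
  let z := finBasis F E.compl
  let v : (H ⊕ H) ⊕ Fin (finrank F E.compl) → M :=
    Sum.elim (Sum.elim E.e E.f) (fun k => (z k : M))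
  have hz : ∀ k h, Q (z k : M) (E.e h) = 0 ∧ Q (z k : M) (E.f h) = 0 :=
    fun k h => E.mem_compl.mp (z k).2 h
  have hz' : ∀ k h, Q (E.e h) (z k : M) = 0 ∧ Q (E.f h) (z k : M) = 0 :=
    fun k h => by rw [hsymm _ _, hsymm (E.f h)]; exact hz k h
  have hef : ∀ h h', Q (E.e h) (E.f h') = if h = h' then 1 else 0 := by
    intro h h'
    split_ifs with hh
    · rw [hh, E.e_f_self]
    · exact E.e_f _ _ hh
  have hfe : ∀ h h', Q (E.f h) (E.e h') = if h = h' then 1 else 0 := by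
    intro h h'
    rw [hsymm, hef]
    simp only [eq_comm]
  have hli : LinearIndependent F v := by
    rw [Fintype.linearIndependent_iff]
    intro g hg
    simp only [Fintype.sum_sum_type, v, Sum.elim_inl, Sum.elim_inr] at hg
    have hl : ∀ h, g (Sum.inl (Sum.inl h)) = 0 := fun h => by
      simpa [E.e_e, E.f_f, hef, hfe, hz] using congrArg (fun x => Q x (E.f h)) hg
    have hr : ∀ h, g (Sum.inl (Sum.inr h)) = 0 := fun h => by
      simpa [E.e_e, E.f_f, hef, hfe, hz] using congrArg (fun x => Q x (E.e h)) hg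
    simp only [hl, hr, zero_smul, Finset.sum_const_zero, zero_add] at hg
    have hk := Fintype.linearIndependent_iff.mp z.linearIndependent
      (fun k => g (Sum.inr k)) (Subtype.ext (by simpa using hg))
    rintro ((h | h) | k)
    exacts [hl h, hr h, hk k]
  have hmem : ∀ (x : M) (s : Set ((H ⊕ H) ⊕ Fin (finrank F E.compl))),
      (∀ h, Q x (E.f h) ≠ 0 → Sum.inl (Sum.inl h) ∈ s) →
      (∀ h, Q x (E.e h) ≠ 0 → Sum.inl (Sum.inr h) ∈ s) →
      (x - E.proj x ≠ 0 → ∀ k, Sum.inr k ∈ s) → x ∈ Submodule.span F (v '' s) := by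
    intro x s hl hr hk
    have hx : x = (x - E.proj x) + E.proj x := by abel
    rw [hx]
    refine Submodule.add_mem _ ?_ (Submodule.sum_mem _ fun h _ => Submodule.add_mem _ ?_ ?_)
    · by_cases h0 : x - E.proj x = 0
      · rw [h0]
        exact Submodule.zero_mem _
      · have hs : ∑ k, z.repr ⟨x - E.proj x, E.sub_proj_mem hsymm x⟩ k • (z k : M) =
            x - E.proj x := by
          simpa only [Submodule.coe_sum, Submodule.coe_smul] using
            congrArg Subtype.val (z.sum_repr ⟨x - E.proj x, E.sub_proj_mem hsymm x⟩)
        rw [← hs]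
        refine Submodule.sum_mem _ fun k _ => Submodule.smul_mem _ _
          (Submodule.subset_span ⟨Sum.inr k, hk h0 k, rfl⟩)
    · by_cases h0 : Q x (E.f h) = 0
      · rw [h0, zero_smul]
        exact Submodule.zero_mem _
      · exact Submodule.smul_mem _ _ (Submodule.subset_span ⟨_, hl h h0, rfl⟩)
    · by_cases h0 : Q x (E.e h) = 0
      · rw [h0, zero_smul]
        exact Submodule.zero_mem _
      · exact Submodule.smul_mem _ _ (Submodule.subset_span ⟨_, hr h h0, rfl⟩)
  have hsp : ⊤ ≤ Submodule.span F (Set.range v) := by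
    intro x _
    rw [← Set.image_univ]
    exact hmem x Set.univ (fun _ _ => trivial) (fun _ _ => trivial) (fun _ _ => trivial)
  refine ⟨Fin (finrank F E.compl), inferInstance, Basis.mk hli hsp,
    Matrix.of fun k k' => Q (z k : M) (z k' : M), ⟨fun k => le_antisymm ?_ ?_,
      fun k => le_antisymm ?_ ?_⟩, ?_⟩
  · intro x hx
    rw [Basis.coe_mk]
    refine hmem x _ (fun h h0 => ?_) (fun h h0 => ?_) (fun h0 l => ?_)
    · show (E.step h).1.castSucc < k
      by_contra hk
      refine h0 (hV.apply_eq_zero ?_ hx (E.f_mem h).1)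
      simp only [Fin.lt_def, Fin.le_def, Fin.val_rev, Fin.val_succ, Fin.val_castSucc] at *
      omega
    · show (E.step h).1.rev.castSucc < k
      by_contra hk
      refine h0 (hV.apply_eq_zero ?_ hx (E.e_mem h).1)
      simp only [Fin.lt_def, Fin.le_def, Fin.val_rev, Fin.val_succ, Fin.val_castSucc] at *
      omega
    · show (midStep n).castSucc < k
      by_contra hk
      have : x - E.proj x ∈ E.compl ⊓ V (midStep n).castSucc :=
        ⟨E.sub_proj_mem hsymm x, hV.mono (not_lt.mp hk)
          (Submodule.sub_mem _ hx (E.proj_mem_left hV hx))⟩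
      rw [h₁] at this
      exact h0 this
  · rw [Basis.coe_mk, Submodule.span_le]
    have hle : E.compl ≤ V (midStep n).succ := by
      rw [hV.orth, Fin.rev_succ, rev_midStep]
      exact E.compl_le_orthB hsymm (fun _ => E.proj_mem_left hV) h₁
    rintro _ ⟨(h | h) | l, hs, rfl⟩
    · exact hV.mono (Fin.castSucc_lt_iff_succ_le.mp hs) (E.e_mem h).1
    · exact hV.mono (Fin.castSucc_lt_iff_succ_le.mp hs) (E.f_mem h).1
    · exact hV.mono (Fin.castSucc_lt_iff_succ_le.mp hs) (hle (z l).2)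
  · intro x hx
    rw [Basis.coe_mk]
    refine hmem x _ (fun h h0 => ?_) (fun h h0 => ?_) (fun h0 l => ?_)
    · show (E.step h).2.castSucc < k
      by_contra hk
      refine h0 (hV'.apply_eq_zero ?_ hx (E.f_mem h).2)
      simp only [Fin.lt_def, Fin.le_def, Fin.val_rev, Fin.val_succ, Fin.val_castSucc] at *
      omega
    · show (E.step h).2.rev.castSucc < k
      by_contra hk
      refine h0 (hV'.apply_eq_zero ?_ hx (E.e_mem h).2)
      simp only [Fin.lt_def, Fin.le_def, Fin.val_rev, Fin.val_succ, Fin.val_castSucc] at *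
      omega
    · show (midStep m).castSucc < k
      by_contra hk
      have : x - E.proj x ∈ E.compl ⊓ V' (midStep m).castSucc :=
        ⟨E.sub_proj_mem hsymm x, hV'.mono (not_lt.mp hk)
          (Submodule.sub_mem _ hx (E.proj_mem_right hV' hx))⟩
      rw [h₂] at this
      exact h0 this
  · rw [Basis.coe_mk, Submodule.span_le]
    have hle : E.compl ≤ V' (midStep m).succ := by
      rw [hV'.orth, Fin.rev_succ, rev_midStep]
      exact E.compl_le_orthB hsymm (fun _ => E.proj_mem_right hV') h₂
    rintro _ ⟨(h | h) | l, hs, rfl⟩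
    · exact hV'.mono (Fin.castSucc_lt_iff_succ_le.mp hs) (E.e_mem h).2
    · exact hV'.mono (Fin.castSucc_lt_iff_succ_le.mp hs) (E.f_mem h).2
    · exact hV'.mono (Fin.castSucc_lt_iff_succ_le.mp hs) (hle (z l).2)
  · rw [Basis.coe_mk]
    rintro ((h | h) | k) ((h' | h') | k') <;>
      simp [v, hyperbolicGram, E.e_e, E.f_f, hef, hfe, hz, hz', Matrix.one_apply]

end AdaptedBasis

section Orbits

variable {F M : Type} [Field F] [AddCommGroup M] [Module F M]

theorem relDim_map {N N' : ℕ} (V : Fin (N + 1) → Submodule F M) (V' : Fin (N' + 1) → Submodule F M)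
    (g : M ≃ₗ[F] M) :
    relDim (fun k => (V k).map (g : M →ₗ[F] M)) (fun k => (V' k).map (g : M →ₗ[F] M)) =
      relDim V V' := by
  funext i j
  have hg : Function.Injective (g : M →ₗ[F] M) := g.injective
  have key : ∀ A B C : Submodule F M, finrank F ↥(A.map (g : M →ₗ[F] M) ⊔
      B.map (g : M →ₗ[F] M) ⊓ C.map (g : M →ₗ[F] M)) = finrank F ↥(A ⊔ B ⊓ C) := by
    intro A B C
    rw [← Submodule.map_inf _ hg, ← Submodule.map_sup, LinearEquiv.finrank_map_eq]
  simp only [relDim, key]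

/-- A basis consisting of orthogonal hyperbolic pairs and of vectors orthogonal to them with Gram
matrix `S`, which is adapted to two flags. -/
structure IsWittBasis {n m : ℕ} {H K : Type} [DecidableEq H] (Q : M →ₗ[F] M →ₗ[F] F)
    (V : Fin (2 * n + 1 + 1) → Submodule F M) (V' : Fin (2 * m + 1 + 1) → Submodule F M)
    (c : H → Fin (2 * n + 1) × Fin (2 * m + 1)) (u : Basis ((H ⊕ H) ⊕ K) F M)
    (S : Matrix K K F) : Prop where
  adapted : IsAdapted u (pairSteps c) V V'
  gram : ∀ s t, Q (u s) (u t) = Matrix.fromBlocks (hyperbolicGram F H) 0 0 S s t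

theorem exists_isWittBasis [FiniteDimensional F M] (h2 : (2 : F) ≠ 0)
    {Q : M →ₗ[F] M →ₗ[F] F} (hsymm : ∀ u v, Q u v = Q v u)
    (hnd : ∀ u, (∀ v, Q u v = 0) → u = 0) {n m : ℕ}
    {V : Fin (2 * n + 1 + 1) → Submodule F M} {V' : Fin (2 * m + 1 + 1) → Submodule F M}
    (hV : IsSelfDualFlag Q V) (hV' : IsSelfDualFlag Q V') :
    ∃ (H K : Type) (_ : Fintype H) (_ : DecidableEq H) (_ : Fintype K)
      (c : H → Fin (2 * n + 1) × Fin (2 * m + 1)) (u : Basis ((H ⊕ H) ⊕ K) F M)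
      (S : Matrix K K F), (∀ h, IsNeg (c h)) ∧ IsWittBasis Q V V' c u S := by
  classical
  obtain ⟨H, hH, E, h₁, h₂⟩ := exists_hyperbolicFamily h2 hsymm hnd hV hV'
  obtain ⟨K, hK, u, S, hu, hS⟩ := E.exists_adapted_basis hsymm hV hV' h₁ h₂
  exact ⟨H, K, hH, inferInstance, hK, E.step, u, S, E.isNeg, hu, hS⟩

section Fibers

variable {n m : ℕ} {H K H' K' : Type} [Fintype H] [Fintype K] [Fintype H'] [Fintype K']

theorem card_fiber_eq {c : H → Fin (2 * n + 1) × Fin (2 * m + 1)} (hc : ∀ h, IsNeg (c h))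
    (p : Fin (2 * n + 1) × Fin (2 * m + 1)) [Decidable (IsNeg p)] :
    (Finset.univ.filter (fun h => c h = p)).card =
      if IsNeg p then (Finset.univ.filter (fun s : (H ⊕ H) ⊕ K => pairSteps c s = p)).card
      else 0 := by
  split_ifs with hp
  · rw [card_pairSteps_fiber, card_fiber_of_not_isNeg hc hp.not_isNeg_revPair, add_zero, if_neg,
      add_zero]
    rintro rfl
    exact not_isNeg_midPair n m hp
  · exact card_fiber_of_not_isNeg hc hp

theorem card_pairSteps_fiber_midPair {c : H → Fin (2 * n + 1) × Fin (2 * m + 1)}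
    (hc : ∀ h, IsNeg (c h)) :
    (Finset.univ.filter (fun s : (H ⊕ H) ⊕ K => pairSteps c s = midPair n m)).card =
      Fintype.card K := by
  rw [card_pairSteps_fiber, revPair_midPair, card_fiber_of_not_isNeg hc (not_isNeg_midPair n m),
    if_pos rfl, zero_add, zero_add]

theorem card_pairSteps_fiber_revPair (c : H → Fin (2 * n + 1) × Fin (2 * m + 1))
    (p : Fin (2 * n + 1) × Fin (2 * m + 1)) :
    (Finset.univ.filter (fun s : (H ⊕ H) ⊕ K => pairSteps c s = revPair p)).card =
      (Finset.univ.filter (fun s : (H ⊕ H) ⊕ K => pairSteps c s = p)).card := by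
  have h : revPair p = midPair n m ↔ p = midPair n m :=
    ⟨fun e => by rw [← revPair_revPair p, e, revPair_midPair],
      fun e => by rw [e, revPair_midPair]⟩
  rw [card_pairSteps_fiber, card_pairSteps_fiber, revPair_revPair]
  simp only [h]
  ring

/-- Two families of steps with the same numbers of members in every step can be matched. -/
theorem exists_equiv_of_card_fiber_eq {c : H → Fin (2 * n + 1) × Fin (2 * m + 1)}
    {c' : H' → Fin (2 * n + 1) × Fin (2 * m + 1)} (hc : ∀ h, IsNeg (c h))
    (hc' : ∀ h, IsNeg (c' h))
    (hcard : ∀ p, (Finset.univ.filter (fun s : (H ⊕ H) ⊕ K => pairSteps c s = p)).card =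
      (Finset.univ.filter (fun s : (H' ⊕ H') ⊕ K' => pairSteps c' s = p)).card) :
    ∃ (e : H ≃ H') (_ : K ≃ K'), ∀ h, c' (e h) = c h := by
  classical
  have hK : Fintype.card K = Fintype.card K' := by
    rw [← card_pairSteps_fiber_midPair hc, hcard, card_pairSteps_fiber_midPair hc']
  have hH : ∀ p, Fintype.card {h // c h = p} = Fintype.card {h // c' h = p} := fun p => by
    rw [Fintype.card_subtype, Fintype.card_subtype, card_fiber_eq (K := K) hc,
      card_fiber_eq (K := K') hc', hcard]
  exact ⟨Equiv.ofFiberEquiv fun p => Fintype.equivOfCardEq (hH p), Fintype.equivOfCardEq hK,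
    fun h => Equiv.ofFiberEquiv_map _ h⟩

end Fibers

namespace IsWittBasis

variable {n m : ℕ} {H K H' K' : Type} [DecidableEq H] [DecidableEq H']
  {Q : M →ₗ[F] M →ₗ[F] F}
  {V W : Fin (2 * n + 1 + 1) → Submodule F M} {V' W' : Fin (2 * m + 1 + 1) → Submodule F M}
  {c : H → Fin (2 * n + 1) × Fin (2 * m + 1)} {c' : H' → Fin (2 * n + 1) × Fin (2 * m + 1)}

theorem reindex {u : Basis ((H ⊕ H) ⊕ K) F M} {S : Matrix K K F} (h : IsWittBasis Q V V' c u S)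
    (e : H ≃ H') (f : K ≃ K') (he : ∀ h, c' (e h) = c h) :
    IsWittBasis Q V V' c' (u.reindex (Equiv.sumCongr (Equiv.sumCongr e e) f)) (S.reindex f f) := by
  set E := Equiv.sumCongr (Equiv.sumCongr e e) f
  have hE : ∀ s, pairSteps c' (E s) = pairSteps c s := by
    rintro ((x | x) | x)
    · exact he x
    · exact congrArg revPair (he x)
    · rfl
  have hE' : ∀ s, pairSteps c (E.symm s) = pairSteps c' s := fun s => by
    rw [← hE, Equiv.apply_symm_apply]
  refine ⟨⟨fun k => ?_, fun k => ?_⟩, fun s t => ?_⟩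
  · rw [h.adapted.left, Basis.coe_reindex, Set.image_comp, Equiv.image_symm_eq_preimage]
    simp only [Set.preimage_ofPred_eq, hE]
  · rw [h.adapted.right, Basis.coe_reindex, Set.image_comp, Equiv.image_symm_eq_preimage]
    simp only [Set.preimage_ofPred_eq, hE]
  · rw [Basis.reindex_apply, Basis.reindex_apply, h.gram]
    rcases s with (s | s) | s <;> rcases t with (t | t) | t <;>
      simp [E, hyperbolicGram, Matrix.one_apply]

variable {u w : Basis ((H ⊕ H) ⊕ K) F M} {S T : Matrix K K F}

theorem isSymm (hsymm : ∀ x y, Q x y = Q y x) (h : IsWittBasis Q V V' c u S) : S.IsSymm :=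
  Matrix.IsSymm.ext fun k l => by
    simpa [h.gram] using hsymm (u (Sum.inr l)) (u (Sum.inr k))

variable [Fintype H] [Fintype K]

theorem relDim_eq (h : IsWittBasis Q V V' c u S) (i : Fin (2 * n + 1)) (j : Fin (2 * m + 1)) :
    relDim V V' i j =
      (Finset.univ.filter (fun s : (H ⊕ H) ⊕ K => pairSteps c s = (i, j))).card :=
  h.adapted.relDim_eq i j

theorem toMatrix_eq [DecidableEq K] (h : IsWittBasis Q V V' c u S) :
    LinearMap.BilinForm.toMatrix u Q = Matrix.fromBlocks (hyperbolicGram F H) 0 0 S := by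
  ext s t
  rw [LinearMap.BilinForm.toMatrix_apply, h.gram]

theorem det_ne_zero [DecidableEq K] (hsymm : ∀ x y, Q x y = Q y x)
    (hnd : ∀ x, (∀ y, Q x y = 0) → x = 0) (h : IsWittBasis Q V V' c u S) : S.det ≠ 0 := by
  have h0 : LinearMap.BilinForm.Nondegenerate Q :=
    ⟨hnd, fun v hv => hnd v fun u => by rw [hsymm, hv]⟩
  have h1 := (LinearMap.BilinForm.nondegenerate_iff_det_ne_zero u).mp h0
  rw [h.toMatrix_eq, Matrix.det_fromBlocks_zero₂₁] at h1
  exact right_ne_zero_of_mul h1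

theorem matCongr [Fintype F] [DecidableEq K] (hodd : Odd (Fintype.card F))
    (hsymm : ∀ x y, Q x y = Q y x) (hnd : ∀ x, (∀ y, Q x y = 0) → x = 0)
    (h : IsWittBasis Q V V' c u S) (h' : IsWittBasis Q W W' c w T) : MatCongr T S := by
  have hdet := congrArg Matrix.det (LinearMap.BilinForm.toMatrix_mul_basis_toMatrix w u Q)
  rw [h.toMatrix_eq, h'.toMatrix_eq, Matrix.det_mul, Matrix.det_mul, Matrix.det_transpose,
    Matrix.det_fromBlocks_zero₂₁, Matrix.det_fromBlocks_zero₂₁] at hdet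
  refine matCongr_of_det_eq hodd (h'.isSymm hsymm) (h.isSymm hsymm) (h'.det_ne_zero hsymm hnd)
    (c := (w.toMatrix u).det) ?_ ?_
  · have := congrArg Matrix.det (w.toMatrix_mul_toMatrix_flip u)
    rw [Matrix.det_mul, Matrix.det_one] at this
    exact left_ne_zero_of_mul (this ▸ one_ne_zero)
  · refine mul_left_cancel₀ (det_hyperbolicGram_ne_zero F H) ?_
    linear_combination -hdet

theorem exists_isometry [Fintype F] (hodd : Odd (Fintype.card F))
    (hsymm : ∀ x y, Q x y = Q y x) (hnd : ∀ x, (∀ y, Q x y = 0) → x = 0)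
    (h : IsWittBasis Q V V' c u S) (h' : IsWittBasis Q W W' c w T) :
    ∃ g : M ≃ₗ[F] M, inIsom Q g ∧ (∀ k, (V k).map (g : M →ₗ[F] M) = W k) ∧
      ∀ k, (V' k).map (g : M →ₗ[F] M) = W' k := by
  classical
  obtain ⟨P, -, hP⟩ := h.matCongr hodd hsymm hnd h'
  let v : (H ⊕ H) ⊕ K → M :=
    Sum.elim (fun s => w (Sum.inl s)) (fun k => ∑ l, P l k • w (Sum.inr l))
  have hv : ∀ s t, Q (v s) (v t) = Q (u s) (u t) := by
    intro s t
    rw [h.gram]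
    rcases s with s | s <;> rcases t with t | t
    · simp [v, h'.gram]
    · simp [v, h'.gram]
    · simp [v, h'.gram]
    · simp only [v, h'.gram, Sum.elim_inr, map_sum, map_smul, LinearMap.sum_apply,
        LinearMap.smul_apply, Matrix.fromBlocks_apply₂₂, smul_eq_mul, ← hP, Matrix.mul_apply,
        Matrix.transpose_apply, Finset.sum_mul, Finset.mul_sum]
      refine Finset.sum_congr rfl fun _ _ => Finset.sum_congr rfl fun _ _ => by ring
  let g₀ : M →ₗ[F] M := u.constr F v
  have hg₀ : ∀ s, g₀ (u s) = v s := fun s => u.constr_basis F v s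
  have hQ : Q.compl₁₂ g₀ g₀ = Q := by
    refine LinearMap.ext_basis u u fun s t => ?_
    rw [LinearMap.compl₁₂_apply, hg₀, hg₀, hv]
  have hQ' : ∀ x y, Q (g₀ x) (g₀ y) = Q x y := fun x y => by
    conv_rhs => rw [← hQ, LinearMap.compl₁₂_apply]
  have hinj : Function.Injective g₀ := by
    rw [← LinearMap.ker_eq_bot, LinearMap.ker_eq_bot']
    intro x hx
    exact hnd x fun y => by rw [← hQ', hx, map_zero, LinearMap.zero_apply]
  have := u.finiteDimensional_of_finite
  have hmap : ∀ (A : Set ((H ⊕ H) ⊕ K)), (∀ k l, Sum.inr k ∈ A → Sum.inr l ∈ A) →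
      (Submodule.span F (u '' A)).map g₀ = Submodule.span F (w '' A) := by
    intro A hA
    refine Submodule.eq_of_le_of_finrank_eq ?_ ?_
    · rw [Submodule.map_span_le]
      rintro _ ⟨s | k, hs, rfl⟩
      · rw [hg₀]
        exact Submodule.subset_span ⟨_, hs, rfl⟩
      · rw [hg₀]
        exact Submodule.sum_mem _ fun l _ => Submodule.smul_mem _ _
          (Submodule.subset_span ⟨_, hA k l hs, rfl⟩)
    · rw [← (Submodule.equivMapOfInjective g₀ hinj _).finrank_eq, finrank_span_image,
        finrank_span_image]
  refine ⟨LinearEquiv.ofInjectiveEndo g₀ hinj, hQ', fun k => ?_, fun k => ?_⟩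
  · rw [h.adapted.left, h'.adapted.left]
    exact hmap _ fun _ _ hk => hk
  · rw [h.adapted.right, h'.adapted.right]
    exact hmap _ fun _ _ hk => hk

end IsWittBasis

/-- Two pairs of self-dual flags with the same relative dimensions are isometric. -/
theorem exists_isometry_of_relDim_eq [FiniteDimensional F M] [Fintype F]
    (hodd : Odd (Fintype.card F)) {Q : M →ₗ[F] M →ₗ[F] F} (hsymm : ∀ u v, Q u v = Q v u)
    (hnd : ∀ u, (∀ v, Q u v = 0) → u = 0) {n m : ℕ}
    {V W : Fin (2 * n + 1 + 1) → Submodule F M} {V' W' : Fin (2 * m + 1 + 1) → Submodule F M}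
    (hV : IsSelfDualFlag Q V) (hV' : IsSelfDualFlag Q V')
    (hW : IsSelfDualFlag Q W) (hW' : IsSelfDualFlag Q W') (h : relDim V V' = relDim W W') :
    ∃ g : M ≃ₗ[F] M, inIsom Q g ∧ (∀ k, (V k).map (g : M →ₗ[F] M) = W k) ∧
      ∀ k, (V' k).map (g : M →ₗ[F] M) = W' k := by
  have h2 := two_ne_zero_of_odd_card hodd
  obtain ⟨H, K, _, _, _, c, u, S, hc, hu⟩ := exists_isWittBasis h2 hsymm hnd hV hV'
  obtain ⟨H', K', _, _, _, c', w, T, hc', hw⟩ := exists_isWittBasis h2 hsymm hnd hW hW'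
  obtain ⟨e, f, he⟩ := exists_equiv_of_card_fiber_eq hc hc' (K := K) (K' := K') fun p => by
    rw [← hu.relDim_eq p.1 p.2, h, hw.relDim_eq]
  exact (hu.reindex e f he).exists_isometry hodd hsymm hnd hw

theorem relDim_eq_iff_exists_isometry [FiniteDimensional F M] [Fintype F]
    (hodd : Odd (Fintype.card F)) {Q : M →ₗ[F] M →ₗ[F] F} (hsymm : ∀ u v, Q u v = Q v u)
    (hnd : ∀ u, (∀ v, Q u v = 0) → u = 0) {n m : ℕ}
    {V W : Fin (2 * n + 1 + 1) → Submodule F M} {V' W' : Fin (2 * m + 1 + 1) → Submodule F M}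
    (hV : IsSelfDualFlag Q V) (hV' : IsSelfDualFlag Q V')
    (hW : IsSelfDualFlag Q W) (hW' : IsSelfDualFlag Q W') :
    relDim V V' = relDim W W' ↔
      ∃ g : M ≃ₗ[F] M, inIsom Q g ∧ (∀ k, (V k).map (g : M →ₗ[F] M) = W k) ∧
        ∀ k, (V' k).map (g : M →ₗ[F] M) = W' k := by
  refine ⟨exists_isometry_of_relDim_eq hodd hsymm hnd hV hV' hW hW', ?_⟩
  rintro ⟨g, -, hg, hg'⟩
  rw [← relDim_map V V' g]
  simp only [hg, hg']

theorem IsSelfDualFlag.relDim_rev [FiniteDimensional F M] (h2 : (2 : F) ≠ 0)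
    {Q : M →ₗ[F] M →ₗ[F] F} (hsymm : ∀ u v, Q u v = Q v u)
    (hnd : ∀ u, (∀ v, Q u v = 0) → u = 0) {n m : ℕ}
    {V : Fin (2 * n + 1 + 1) → Submodule F M} {V' : Fin (2 * m + 1 + 1) → Submodule F M}
    (hV : IsSelfDualFlag Q V) (hV' : IsSelfDualFlag Q V') (i : Fin (2 * n + 1))
    (j : Fin (2 * m + 1)) : relDim V V' i j = relDim V V' i.rev j.rev := by
  obtain ⟨H, K, _, _, _, c, u, S, -, hu⟩ := exists_isWittBasis h2 hsymm hnd hV hV'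
  rw [hu.relDim_eq, hu.relDim_eq]
  exact (card_pairSteps_fiber_revPair c (i, j)).symm

end Orbits

section Realization

variable {F M : Type} [Field F] [AddCommGroup M] [Module F M]

theorem exists_basis_toMatrix_eq [FiniteDimensional F M] [Fintype F]
    (hodd : Odd (Fintype.card F)) {Q : M →ₗ[F] M →ₗ[F] F} (hsymm : ∀ u v, Q u v = Q v u)
    (hnd : ∀ u, (∀ v, Q u v = 0) → u = 0) {ι : Type} [Fintype ι] [DecidableEq ι]
    (hcard : Fintype.card ι = finrank F M) {S : F → Matrix ι ι F} (hS : ∀ δ, (S δ).IsSymm)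
    {a : F} (ha : a ≠ 0) (hdet : ∀ δ, (S δ).det = a * δ) :
    ∃ (u : Basis ι F M) (δ : F), δ ≠ 0 ∧ LinearMap.BilinForm.toMatrix u Q = S δ := by
  let b : Basis ι F M := (finBasis F M).reindex
    (Fintype.equivOfCardEq (by rw [Fintype.card_fin, hcard]))
  set T := LinearMap.BilinForm.toMatrix b Q
  have h0 : LinearMap.BilinForm.Nondegenerate Q :=
    ⟨hnd, fun v hv => hnd v fun u => by rw [hsymm, hv]⟩
  have hT : T.det ≠ 0 := (LinearMap.BilinForm.nondegenerate_iff_det_ne_zero b).mp h0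
  have hTs : T.IsSymm := Matrix.IsSymm.ext fun i j => by
    simpa only [T, LinearMap.BilinForm.toMatrix_apply] using hsymm (b j) (b i)
  obtain ⟨P, hP, hPT⟩ := matCongr_of_det_eq hodd hTs (hS (a⁻¹ * T.det)) hT one_ne_zero
    (by rw [hdet]; field_simp)
  have hu : b.toMatrix (b.map (Matrix.toLinearEquiv b P hP.isUnit)) = P := by
    ext i j
    simp [Basis.toMatrix_apply, Matrix.toLinearEquiv, Matrix.toLin_self, Finsupp.single_apply]
  refine ⟨b.map (Matrix.toLinearEquiv b P hP.isUnit), a⁻¹ * T.det,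
    mul_ne_zero (inv_ne_zero ha) hT, ?_⟩
  rw [← hPT, ← LinearMap.BilinForm.toMatrix_mul_basis_toMatrix b, hu]

/-- The flag spanned by the vectors of a basis which the form pairs off compatibly with the
steps is self-dual. -/
theorem isSelfDualFlag_span {Q : M →ₗ[F] M →ₗ[F] F} {ι : Type} [Fintype ι] [DecidableEq ι]
    {u : Basis ι F M} {σ : ι → ι} (hσ : Function.Injective σ) {w : ι → F} (hw : ∀ s, w s ≠ 0)
    (hu : ∀ s t, Q (u s) (u t) = if t = σ s then w s else 0) {n : ℕ} {a : ι → Fin (2 * n + 1)}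
    (ha : ∀ s, a (σ s) = (a s).rev) :
    IsSelfDualFlag Q (fun k => Submodule.span F (u '' {s | (a s).castSucc < k})) where
  mono k l hkl := Submodule.span_mono (Set.image_mono fun _ hs => lt_of_lt_of_le hs hkl)
  zero := by simp
  last := by simp [Fin.castSucc_lt_last]
  orth k := by
    have hlt : ∀ s, (a (σ s)).castSucc < k.rev ↔ ¬ (a s).castSucc < k := by
      intro s
      rw [ha, ← Fin.rev_succ, Fin.rev_lt_rev, not_lt, Fin.lt_def, Fin.le_def, Fin.val_succ,
        Fin.val_castSucc]
      omega
    ext x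
    rw [mem_orthB]
    constructor
    · intro hx y hy
      induction hx, hy using Submodule.span_induction₂ with
      | mem_mem x y hx hy =>
        obtain ⟨s, hs, rfl⟩ := hx
        obtain ⟨t, ht, rfl⟩ := hy
        rw [hu, if_neg]
        rintro rfl
        exact (hlt s).mp ht hs
      | zero_left => simp
      | zero_right => simp
      | add_left x y z _ _ _ h₁ h₂ => simp [h₁, h₂]
      | add_right x y z _ _ _ h₁ h₂ => simp [h₁, h₂]
      | smul_left r x y _ _ h => simp [h]
      | smul_right r x y _ _ h => simp [h]
    · intro hx
      rw [Basis.mem_span_image]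
      intro t ht
      by_contra hk
      have h0 := hx (u (σ t)) (Submodule.subset_span ⟨_, (hlt t).mpr hk, rfl⟩)
      rw [← u.sum_repr x] at h0
      simp only [map_sum, map_smul, LinearMap.sum_apply, LinearMap.smul_apply, hu, hσ.eq_iff,
        smul_eq_mul, mul_ite, mul_zero, Finset.sum_ite_eq, Finset.mem_univ, if_true] at h0
      exact (Finsupp.mem_support_iff.mp ht) ((mul_eq_zero.mp h0).resolve_right (hw t))

theorem exists_isSelfDualFlag_span [FiniteDimensional F M] [Fintype F]
    (hodd : Odd (Fintype.card F)) {Q : M →ₗ[F] M →ₗ[F] F} (hsymm : ∀ u v, Q u v = Q v u)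
    (hnd : ∀ u, (∀ v, Q u v = 0) → u = 0) {n m : ℕ} {H K : Type} [Fintype H] [Fintype K]
    [Nonempty K] (hcard : Fintype.card ((H ⊕ H) ⊕ K) = finrank F M)
    (c : H → Fin (2 * n + 1) × Fin (2 * m + 1)) :
    ∃ (V : Fin (2 * n + 1 + 1) → Submodule F M) (V' : Fin (2 * m + 1 + 1) → Submodule F M)
      (u : Basis ((H ⊕ H) ⊕ K) F M),
      IsSelfDualFlag Q V ∧ IsSelfDualFlag Q V' ∧ IsAdapted u (pairSteps c) V V' := by
  classical
  obtain ⟨k₀⟩ := ‹Nonempty K›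
  obtain ⟨u, δ, hδ, hu⟩ := exists_basis_toMatrix_eq hodd hsymm hnd hcard
    (S := fun δ => Matrix.fromBlocks (hyperbolicGram F H) 0 0
      (Matrix.diagonal (Function.update (1 : K → F) k₀ δ)))
    (fun δ => by
      simp [hyperbolicGram, Matrix.IsSymm, Matrix.fromBlocks_transpose])
    (det_hyperbolicGram_ne_zero F H) (fun δ => by
      rw [Matrix.det_fromBlocks_zero₂₁, Matrix.det_diagonal,
        Finset.prod_update_of_mem (Finset.mem_univ _)]
      simp)
  have hσ : Function.Injective (Sum.map Sum.swap id : (H ⊕ H) ⊕ K → (H ⊕ H) ⊕ K) :=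
    Function.Involutive.injective (by rintro ((h | h) | k) <;> rfl)
  let w : (H ⊕ H) ⊕ K → F := Sum.elim 1 (Function.update 1 k₀ δ)
  have hw : ∀ s, w s ≠ 0 := by
    rintro (s | k)
    · exact one_ne_zero
    · by_cases hk : k = k₀ <;> simp [w, hk, hδ]
  have hQ : ∀ s t, Q (u s) (u t) = if t = Sum.map Sum.swap id s then w s else 0 := by
    intro s t
    rw [← LinearMap.BilinForm.toMatrix_apply, hu]
    rcases s with (s | s) | s <;> rcases t with (t | t) | t <;>
      simp [w, hyperbolicGram, Matrix.one_apply, Matrix.diagonal_apply, eq_comm]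
  exact ⟨_, _, u,
    isSelfDualFlag_span hσ hw hQ (fun s => congrArg Prod.fst (pairSteps_swap c s)),
    isSelfDualFlag_span hσ hw hQ (fun s => congrArg Prod.snd (pairSteps_swap c s)),
    ⟨fun _ => rfl, fun _ => rfl⟩⟩

/-- Every matrix of nonnegative integers which is symmetric under reversal of the steps and has
the correct sum is the matrix of relative dimensions of two self-dual flags. -/
theorem exists_relDim_eq [FiniteDimensional F M] [Fintype F]
    (hodd : Odd (Fintype.card F)) {Q : M →ₗ[F] M →ₗ[F] F} (hsymm : ∀ u v, Q u v = Q v u)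
    (hnd : ∀ u, (∀ v, Q u v = 0) → u = 0) (hM : Odd (finrank F M)) {n m : ℕ}
    {A : Fin (2 * n + 1) → Fin (2 * m + 1) → ℕ} (hsum : ∑ i, ∑ j, A i j = finrank F M)
    (hA : ∀ i j, A i j = A i.rev j.rev) :
    ∃ (V : Fin (2 * n + 1 + 1) → Submodule F M) (V' : Fin (2 * m + 1 + 1) → Submodule F M),
      IsSelfDualFlag Q V ∧ IsSelfDualFlag Q V' ∧ relDim V V' = A := by
  classical
  let H := Σ p : {p : Fin (2 * n + 1) × Fin (2 * m + 1) // IsNeg p}, Fin (A p.1.1 p.1.2)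
  let K := Fin (A (midStep n) (midStep m))
  let c : H → Fin (2 * n + 1) × Fin (2 * m + 1) := fun h => h.1.1
  have hc : ∀ h, IsNeg (c h) := fun h => h.1.2
  have hneg : ∀ p, IsNeg p → (Finset.univ.filter (fun h => c h = p)).card = A p.1 p.2 := by
    intro p hp
    rw [Finset.card_filter, Fintype.sum_sigma, Finset.sum_eq_single ⟨p, hp⟩]
    · simp [c]
    · intro q _ hq
      refine Finset.sum_eq_zero fun _ _ => if_neg fun h => hq (Subtype.ext h)
    · simp
  have hfib : ∀ p, (Finset.univ.filter (fun s : (H ⊕ H) ⊕ K => pairSteps c s = p)).card =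
      A p.1 p.2 := by
    intro p
    have hp : ∀ p, IsNeg p →
        (Finset.univ.filter (fun s : (H ⊕ H) ⊕ K => pairSteps c s = p)).card = A p.1 p.2 := by
      intro p hp
      rw [← hneg p hp, card_fiber_eq (K := K) hc, if_pos hp]
    rcases isNeg_trichotomy p with h | h | rfl
    · exact hp p h
    · rw [← card_pairSteps_fiber_revPair, hp _ h, hA p.1]
      rfl
    · rw [card_pairSteps_fiber_midPair hc, Fintype.card_fin]
      rfl
  have hcard : Fintype.card ((H ⊕ H) ⊕ K) = finrank F M := by
    rw [← hsum, ← Fintype.sum_prod_type', ← Finset.card_univ,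
      Finset.card_eq_sum_card_fiberwise (f := pairSteps c) (t := Finset.univ)
        (fun _ _ => Finset.mem_univ _)]
    exact Finset.sum_congr rfl fun p _ => hfib p
  have : Nonempty K := by
    rw [← Fintype.card_pos_iff]
    rw [← hcard, Fintype.card_sum, Fintype.card_sum] at hM
    obtain ⟨r, hr⟩ := hM
    omega
  obtain ⟨V, V', u, hV, hV', hu⟩ := exists_isSelfDualFlag_span hodd hsymm hnd hcard c
  exact ⟨V, V', hV, hV', funext₂ fun i j => by rw [hu.relDim_eq, hfib]⟩

end Realization

section Sums

variable {F M : Type} [Field F] [AddCommGroup M] [Module F M] [FiniteDimensional F M]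
  {Q : M →ₗ[F] M →ₗ[F] F} {n m : ℕ}
  {V : Fin (2 * n + 1 + 1) → Submodule F M} {V' : Fin (2 * m + 1 + 1) → Submodule F M}

theorem IsSelfDualFlag.sum_sum_relDim (h2 : (2 : F) ≠ 0) (hsymm : ∀ u v, Q u v = Q v u)
    (hnd : ∀ u, (∀ v, Q u v = 0) → u = 0) (hV : IsSelfDualFlag Q V)
    (hV' : IsSelfDualFlag Q V') : ∑ i, ∑ j, relDim V V' i j = finrank F M := by
  obtain ⟨H, K, _, _, _, c, u, S, -, hu⟩ := exists_isWittBasis h2 hsymm hnd hV hV'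
  rw [hu.adapted.sum_sum_relDim, finrank_eq_card_basis u]

theorem IsSelfDualFlag.sum_relDim_add (h2 : (2 : F) ≠ 0) (hsymm : ∀ u v, Q u v = Q v u)
    (hnd : ∀ u, (∀ v, Q u v = 0) → u = 0) (hV : IsSelfDualFlag Q V)
    (hV' : IsSelfDualFlag Q V') (j : Fin (2 * m + 1)) :
    ∑ i, relDim V V' i j + finrank F (V' j.castSucc) = finrank F (V' j.succ) := by
  obtain ⟨H, K, _, _, _, c, u, S, -, hu⟩ := exists_isWittBasis h2 hsymm hnd hV hV'
  exact hu.adapted.sum_relDim_add j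

/-- The second flag is complete if and only if the relative dimensions have column sums `1`. -/
theorem IsSelfDualFlag.finrank_eq_val_iff (h2 : (2 : F) ≠ 0) (hsymm : ∀ u v, Q u v = Q v u)
    (hnd : ∀ u, (∀ v, Q u v = 0) → u = 0) (hV : IsSelfDualFlag Q V)
    (hV' : IsSelfDualFlag Q V') :
    (∀ k, finrank F (V' k) = (k : ℕ)) ↔ ∀ j, ∑ i, relDim V V' i j = 1 := by
  have hadd := hV.sum_relDim_add h2 hsymm hnd hV'
  constructor
  · intro h j
    have := hadd j
    rw [h, h, Fin.val_succ, Fin.val_castSucc] at this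
    omega
  · intro h k
    induction k using Fin.induction with
    | zero => simp [hV'.zero]
    | succ j ih => rw [← hadd, h, ih, Fin.val_succ, Fin.val_castSucc, add_comm]

end Sums

theorem isXFlag_iff {n d : ℕ} {F : Type} [Field F]
    {Q : (Fin (2*d+1) → F) →ₗ[F] (Fin (2*d+1) → F) →ₗ[F] F}
    {V : Fin (2*n+1+1) → Submodule F (Fin (2*d+1) → F)} :
    IsXFlag n d F Q V ↔ IsSelfDualFlag Q V :=
  ⟨fun h => ⟨h.1, h.2.1, h.2.2.1, h.2.2.2⟩, fun h => ⟨h.mono, h.zero, h.last, h.orth⟩⟩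

theorem isYFlag_iff {d : ℕ} {F : Type} [Field F]
    {Q : (Fin (2*d+1) → F) →ₗ[F] (Fin (2*d+1) → F) →ₗ[F] F}
    {V : Fin (2*d+1+1) → Submodule F (Fin (2*d+1) → F)} :
    IsYFlag d F Q V ↔ IsSelfDualFlag Q V ∧ ∀ i, finrank F (V i) = (i : ℕ) :=
  ⟨fun h => ⟨⟨h.1, h.2.1, h.2.2.1, h.2.2.2.2⟩, h.2.2.2.1⟩,
    fun h => ⟨h.1.mono, h.1.zero, h.1.last, h.2, h.1.orth⟩⟩

/-- The assignment `(V,V') ↦ A` is constant on `O(D)`-orbits of `X×X` and induces a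
bijection from the set of `O(D)`-orbits onto `Ξ_d`; likewise `(V,F) ↦ B` induces a
bijection from the set of `O(D)`-orbits on `X×Y` onto `Π`. -/
theorem stmt0 (n d : ℕ) (hn : 0 < n) (hd : 0 < d)
    (F : Type) [Field F] [Fintype F] (hodd : Odd (Fintype.card F))
    (Q : (Fin (2*d+1) → F) →ₗ[F] (Fin (2*d+1) → F) →ₗ[F] F)
    (hQsymm : ∀ u u', Q u u' = Q u' u)
    (hQnd : ∀ u, (∀ u', Q u u' = 0) → u = 0) :
    -- (a) the matrix of a pair of flags in `X×X` lies in `Ξ_d`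
    (∀ V V', IsXFlag n d F Q V → IsXFlag n d F Q V' →
      (∑ i, ∑ j, matXX n d F V V' i j) = 2*d+1
        ∧ ∀ i j, matXX n d F V V' i j = matXX n d F V V' i.rev j.rev)
    -- (b) every matrix in `Ξ_d` arises this way
    ∧ (∀ A : Matrix (Fin (2*n+1)) (Fin (2*n+1)) ℕ,
        ((∑ i, ∑ j, A i j) = 2*d+1 ∧ ∀ i j, A i j = A i.rev j.rev) →
        ∃ V V', IsXFlag n d F Q V ∧ IsXFlag n d F Q V' ∧ matXX n d F V V' = A)
    -- (c) two pairs have the same matrix iff they lie in the same `O(D)`-orbit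
    ∧ (∀ V V' W W', IsXFlag n d F Q V → IsXFlag n d F Q V' →
        IsXFlag n d F Q W → IsXFlag n d F Q W' →
        (matXX n d F V V' = matXX n d F W W' ↔
          ∃ g : (Fin (2*d+1) → F) ≃ₗ[F] (Fin (2*d+1) → F), inIsom Q g
            ∧ (∀ i, (V i).map (g : (Fin (2*d+1) → F) →ₗ[F] (Fin (2*d+1) → F)) = W i)
            ∧ (∀ i, (V' i).map (g : (Fin (2*d+1) → F) →ₗ[F] (Fin (2*d+1) → F)) = W' i)))
    -- (a') the matrix of a pair in `X×Y` lies in `Π`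
    ∧ (∀ V Fl, IsXFlag n d F Q V → IsYFlag d F Q Fl →
      (∀ j, ∑ i, matXY n d F V Fl i j = 1)
        ∧ ∀ i j, matXY n d F V Fl i j = matXY n d F V Fl i.rev j.rev)
    -- (b') every matrix in `Π` arises this way
    ∧ (∀ B : Matrix (Fin (2*n+1)) (Fin (2*d+1)) ℕ,
        ((∀ j, ∑ i, B i j = 1) ∧ ∀ i j, B i j = B i.rev j.rev) →
        ∃ V Fl, IsXFlag n d F Q V ∧ IsYFlag d F Q Fl ∧ matXY n d F V Fl = B)
    -- (c') fibers of the assignment on `X×Y` are exactly the `O(D)`-orbits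
    ∧ (∀ V Fl W Gl, IsXFlag n d F Q V → IsYFlag d F Q Fl →
        IsXFlag n d F Q W → IsYFlag d F Q Gl →
        (matXY n d F V Fl = matXY n d F W Gl ↔
          ∃ g : (Fin (2*d+1) → F) ≃ₗ[F] (Fin (2*d+1) → F), inIsom Q g
            ∧ (∀ i, (V i).map (g : (Fin (2*d+1) → F) →ₗ[F] (Fin (2*d+1) → F)) = W i)
            ∧ (∀ i, (Fl i).map (g : (Fin (2*d+1) → F) →ₗ[F] (Fin (2*d+1) → F)) = Gl i))) := by
  have h2 : (2 : F) ≠ 0 := two_ne_zero_of_odd_card hodd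
  have hrank : finrank F (Fin (2*d+1) → F) = 2*d+1 := by simp
  have hM : Odd (finrank F (Fin (2*d+1) → F)) := by rw [hrank]; exact ⟨d, rfl⟩
  simp only [isXFlag_iff, isYFlag_iff]
  refine ⟨fun V V' hV hV' => ⟨?_, hV.relDim_rev h2 hQsymm hQnd hV'⟩, fun A hA => ?_,
    fun V V' W W' hV hV' hW hW' =>
      relDim_eq_iff_exists_isometry hodd hQsymm hQnd hV hV' hW hW',
    fun V Fl hV hFl => ⟨(hV.finrank_eq_val_iff h2 hQsymm hQnd hFl.1).mp hFl.2,
      hV.relDim_rev h2 hQsymm hQnd hFl.1⟩, fun B hB => ?_,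
    fun V Fl W Gl hV hFl hW hGl =>
      relDim_eq_iff_exists_isometry hodd hQsymm hQnd hV hFl.1 hW hGl.1⟩
  · exact (hV.sum_sum_relDim h2 hQsymm hQnd hV').trans hrank
  · exact exists_relDim_eq hodd hQsymm hQnd hM (hA.1.trans hrank.symm) hA.2
  · have hsum : ∑ i, ∑ j, B i j = finrank F (Fin (2*d+1) → F) := by
      refine Finset.sum_comm.trans ?_
      simp [hB.1]
    obtain ⟨V, Fl, hV, hFl, h⟩ := exists_relDim_eq hodd hQsymm hQnd hM hsum hB.2
    refine ⟨V, Fl, hV, ⟨hFl, (hV.finrank_eq_val_iff h2 hQsymm hQnd hFl).mpr ?_⟩, h⟩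
    rw [h]
    exact hB.1
end
end

section
/- Let T be the free A-module with basis {e_r : r=(r_1,…,r_d) ∈ {1,…,N}^d}. For 1≤j≤d−1 define an operator on T by: e_r T_j = e_{s_j(r)} if r_j < r_{j+1}; e_r T_j = v² e_r if r_j = r_{j+1}; e_r T_j = (v²−1) e_r + v² e_{s_j(r)} if r_j > r_{j+1}, where s_j(r) is r with entries r_j and r_{j+1} swapped. Define an operator T_d by: e_r T_d = e_{r'} if r_d < n+1; e_r T_d = v² e_r if r_d = n+1; e_r T_d = (v²−1) e_r + v² e_{r'} if r_d > n+1, where r' is r with last entry replaced by N+1−r_d. Then these operators define a right H_{B_d}-module structure on T, i.e., they satisfy (T_i − v²)(T_i + 1) = 0 for all i, T_i T_{i+1} T_i = T_{i+1} T_i T_{i+1} for 1 ≤ i ≤ d−2, T_i T_j = T_j T_i for |i−j| > 1, and T_d T_{d−1} T_d T_{d−1} = T_{d−1} T_d T_{d−1} T_d. -/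
noncomputable section

/-- `v ∈ 𝒜 = ℤ[v,v⁻¹]`. -/
def vv : LaurentPolynomial ℤ := LaurentPolynomial.T 1

/-- The free `𝒜`-module `𝐓` with basis `e_r`, `r ∈ {1,…,N}^d` (`N = 2n+1`). -/
abbrev TB (n d : ℕ) := (Fin d → Fin (2*n+1)) →₀ LaurentPolynomial ℤ

/-- The value on the basis element `e_r` of the operator acting at a pair of positions
`a < b` (for `T_j`, `a = j`, `b = j+1`):
`e_r ↦ e_{s(r)}` if `r_a < r_b`, `e_r ↦ v² e_r` if `r_a = r_b`, and
`e_r ↦ (v²−1) e_r + v² e_{s(r)}` if `r_a > r_b`, where `s(r)` swaps the `a,b` entries. -/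
def bop (n d : ℕ) (a b : Fin d) (r : Fin d → Fin (2*n+1)) : TB n d :=
  if r a < r b then Finsupp.single (r ∘ Equiv.swap a b) 1
  else if r a = r b then Finsupp.single r (vv^2)
  else Finsupp.single r (vv^2 - 1) + Finsupp.single (r ∘ Equiv.swap a b) (vv^2)

/-- The value on the basis element `e_r` of the operator `T_d`:
`e_r ↦ e_{r'}` if `r_d < n+1`, `e_r ↦ v² e_r` if `r_d = n+1`, and
`e_r ↦ (v²−1) e_r + v² e_{r'}` if `r_d > n+1`, where `r'` replaces the last entry
`r_d` by `N+1−r_d`. -/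
def tdop (n d : ℕ) (hd : 0 < d) (r : Fin d → Fin (2*n+1)) : TB n d :=
  let ld : Fin d := ⟨d - 1, by omega⟩
  let r' := Function.update r ld (Fin.rev (r ld))
  if (r ld : ℕ) < n then Finsupp.single r' 1
  else if (r ld : ℕ) = n then Finsupp.single r (vv^2)
  else Finsupp.single r (vv^2 - 1) + Finsupp.single r' (vv^2)

/-- The family of operators `T_1, …, T_d` on `𝐓` (`TfamB i` is `T_{i+1}`; the operator
at the last index is `T_d`). -/
def TfamB (n d : ℕ) (hd : 0 < d) (i : Fin d) : Module.End (LaurentPolynomial ℤ) (TB n d) :=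
  if h : (i : ℕ) + 1 < d then
    (Finsupp.lift (TB n d) (LaurentPolynomial ℤ) _) (bop n d i ⟨(i : ℕ) + 1, h⟩)
  else (Finsupp.lift (TB n d) (LaurentPolynomial ℤ) _) (tdop n d hd)

section Abstract

variable {R M X : Type*} [CommRing R] [AddCommGroup M] [Module R M]

/-- `T` acts on the family `E x y` by the Hecke operator exchanging `x` and `y`. -/
def IsSwap [LinearOrder X] (q : R) (T : Module.End R M) (E : X → X → M) : Prop :=
  ∀ x y, T (E x y) =
    if x < y then E y x else if x = y then q • E x y else (q - 1) • E x y + q • E y x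

/-- `S` acts on the family `E x` by the Hecke operator exchanging `x` and `ρ x`, where `g`
records the position of `x` relative to the fixed point of `ρ`. -/
def IsFlip (q : R) (ρ : X → X) (g : X → ℤ) (S : Module.End R M) (E : X → M) : Prop :=
  ∀ x, S (E x) =
    if g x < 0 then E (ρ x) else if g x = 0 then q • E x else (q - 1) • E x + q • E (ρ x)

variable {q : R} {S T : Module.End R M} {ρ : X → X} {g : X → ℤ}

theorem IsFlip.of_neg {E : X → M} (h : IsFlip q ρ g S E) {x : X} (hx : g x < 0) :
    S (E x) = E (ρ x) := by
  simp [h x, hx]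

theorem IsFlip.of_eq_zero {E : X → M} (h : IsFlip q ρ g S E) {x : X} (hx : g x = 0) :
    S (E x) = q • E x := by
  simp [h x, hx]

theorem IsFlip.of_pos {E : X → M} (h : IsFlip q ρ g S E) {x : X} (hx : 0 < g x) :
    S (E x) = (q - 1) • E x + q • E (ρ x) := by
  simp [h x, hx.not_gt, hx.ne']

theorem IsFlip.quadratic {E : X → M} (h : IsFlip q ρ g S E) (hρ : ∀ x, ρ (ρ x) = x)
    (hg : ∀ x, g (ρ x) = - g x) (x : X) :
    S (S (E x)) = (q - 1) • S (E x) + q • E x := by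
  rcases lt_trichotomy (g x) 0 with hx | hx | hx
  · simp [h _, hg, hρ, hx, hx.not_gt, hx.ne]
  · simp only [h x, hx, lt_irrefl, if_false, if_true, map_smul]; module
  · simp only [h _, hg, hρ, hx, hx.not_gt, hx.ne', if_true, if_false, map_smul, map_add,
      Left.neg_neg_iff]

variable [LinearOrder X]

theorem IsSwap.of_lt {E : X → X → M} (h : IsSwap q T E) {x y : X} (hxy : x < y) :
    T (E x y) = E y x := by
  simp [h x y, hxy]

theorem IsSwap.self {E : X → X → M} (h : IsSwap q T E) (x : X) :
    T (E x x) = q • E x x := by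
  simp [h x x]

theorem IsSwap.of_gt {E : X → X → M} (h : IsSwap q T E) {x y : X} (hxy : y < x) :
    T (E x y) = (q - 1) • E x y + q • E y x := by
  simp [h x y, hxy.not_gt, hxy.ne']

theorem IsSwap.quadratic {E : X → X → M} (h : IsSwap q T E) (x y : X) :
    T (T (E x y)) = (q - 1) • T (E x y) + q • E x y := by
  rcases lt_trichotomy x y with hxy | rfl | hxy
  · simp [h _ _, hxy, hxy.not_gt, hxy.ne']
  · simp only [h x x, lt_irrefl, if_false, if_true, map_smul]; module
  · simp only [h _ _, hxy, hxy.not_gt, hxy.ne', if_true, if_false, map_smul, map_add]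

theorem IsSwap.braid {E : X → X → X → M} (hT : ∀ z, IsSwap q T (fun x y => E x y z))
    (hS : ∀ x, IsSwap q S (E x)) (x y z : X) :
    T (S (T (E x y z))) = S (T (S (E x y z))) := by
  have hT₁ : ∀ x y z, x < y → T (E x y z) = E y x z := fun _ _ z h => (hT z).of_lt h
  have hT₂ : ∀ x z, T (E x x z) = q • E x x z := fun x z => (hT z).self x
  have hT₃ : ∀ x y z, y < x → T (E x y z) = (q - 1) • E x y z + q • E y x z :=
    fun _ _ z h => (hT z).of_gt h
  have hS₁ : ∀ x y z, y < z → S (E x y z) = E x z y := fun x _ _ h => (hS x).of_lt h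
  have hS₂ : ∀ x y, S (E x y y) = q • E x y y := fun x y => (hS x).self y
  have hS₃ : ∀ x y z, z < y → S (E x y z) = (q - 1) • E x y z + q • E x z y :=
    fun x _ _ h => (hS x).of_gt h
  rcases lt_trichotomy x y with hxy | hxy | hxy <;>
  rcases lt_trichotomy y z with hyz | hyz | hyz <;>
  rcases lt_trichotomy x z with hxz | hxz | hxz <;>
  first
  | (exfalso; order)
  | (subst_vars
     simp (disch := assumption) only [hT₁, hT₂, hT₃, hS₁, hS₂, hS₃, map_smul, map_add]
     try module)

theorem IsSwap.commute {E : X → X → X → X → M} (hT : ∀ z w, IsSwap q T (fun x y => E x y z w))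
    (hS : ∀ x y, IsSwap q S (E x y)) (x y z w : X) :
    T (S (E x y z w)) = S (T (E x y z w)) := by
  have hT₁ : ∀ x y z w, x < y → T (E x y z w) = E y x z w := fun _ _ z w h => (hT z w).of_lt h
  have hT₂ : ∀ x z w, T (E x x z w) = q • E x x z w := fun x z w => (hT z w).self x
  have hT₃ : ∀ x y z w, y < x → T (E x y z w) = (q - 1) • E x y z w + q • E y x z w :=
    fun _ _ z w h => (hT z w).of_gt h
  rcases lt_trichotomy x y with hxy | rfl | hxy <;>
  rcases lt_trichotomy z w with hzw | rfl | hzw <;>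
  simp (disch := assumption) only [hT₁, hT₂, hT₃, (hS _ _).of_lt, (hS _ _).self, (hS _ _).of_gt,
    map_smul, map_add] <;>
  module

theorem IsSwap.commute_isFlip {E : X → X → X → M} (hT : ∀ z, IsSwap q T (fun x y => E x y z))
    (hS : ∀ x y, IsFlip q ρ g S (E x y)) (x y z : X) :
    T (S (E x y z)) = S (T (E x y z)) := by
  have hT₁ : ∀ x y z, x < y → T (E x y z) = E y x z := fun _ _ z h => (hT z).of_lt h
  have hT₂ : ∀ x z, T (E x x z) = q • E x x z := fun x z => (hT z).self x
  have hT₃ : ∀ x y z, y < x → T (E x y z) = (q - 1) • E x y z + q • E y x z :=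
    fun _ _ z h => (hT z).of_gt h
  rcases lt_trichotomy x y with hxy | rfl | hxy <;>
  rcases lt_trichotomy (g z) 0 with hz | hz | hz <;>
  simp (disch := assumption) only [hT₁, hT₂, hT₃, (hS _ _).of_neg, (hS _ _).of_eq_zero,
    (hS _ _).of_pos, map_smul, map_add] <;>
  module

theorem IsSwap.braid_isFlip {E : X → X → M} (hT : IsSwap q T E)
    (hS : ∀ x, IsFlip q ρ g S (E x)) (hρ : ∀ x, ρ (ρ x) = x) (hg : ∀ x, g (ρ x) = - g x)
    (hlt : ∀ x y, x < y ↔ g x < g y) (x y : X) :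
    S (T (S (T (E x y)))) = T (S (T (S (E x y)))) := by
  have hinj : ∀ x y, g x = g y → x = y := fun x y h =>
    le_antisymm (not_lt.1 fun h' => by have := (hlt _ _).1 h'; omega)
      (not_lt.1 fun h' => by have := (hlt _ _).1 h'; omega)
  have hS₁ : ∀ x y, g y < 0 → S (E x y) = E x (ρ y) := fun x _ h => (hS x).of_neg h
  have hS₂ : ∀ x y, g y = 0 → S (E x y) = q • E x y := fun x _ h => (hS x).of_eq_zero h
  have hS₃ : ∀ x y, 0 < g y → S (E x y) = (q - 1) • E x y + q • E x (ρ y) :=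
    fun x _ h => (hS x).of_pos h
  have hT₁ : ∀ x y, g x < g y → T (E x y) = E y x := fun x y h => hT.of_lt ((hlt x y).2 h)
  have hT₃ : ∀ x y, g y < g x → T (E x y) = (q - 1) • E x y + q • E y x :=
    fun x y h => hT.of_gt ((hlt y x).2 h)
  rcases lt_trichotomy (g x) (g y) with hxy | hxy | hxy <;>
  rcases lt_trichotomy (g x) (g (ρ y)) with hxz | hxz | hxz <;>
  rcases lt_trichotomy (g x) 0 with hx | hx | hx <;>
  rcases lt_trichotomy (g y) 0 with hy | hy | hy <;>
  first
  | (exfalso; rw [hg] at hxz; omega)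
  | (try obtain rfl := hinj _ _ hxy
     try obtain rfl := hinj _ _ hxz
     try rw [hg] at hxz
     try rw [hg] at hx
     try rw [hg] at hxy
     simp (disch := ((try simp only [hg]); omega)) only [hS₁, hS₂, hS₃, hT₁, hT.self, hT₃, hρ,
       map_smul, map_add]
     try module)

end Abstract

section TensorSpace

variable {n d : ℕ}

theorem single_eq_smul_single_one {ι R : Type*} [Semiring R] (r : ι) (c : R) :
    Finsupp.single r c = c • Finsupp.single r (1 : R) := by simp

theorem isSwap_bop {a b : Fin d} (F : Fin (2*n+1) → Fin (2*n+1) → Fin d → Fin (2*n+1))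
    (ha : ∀ x y, F x y a = x) (hb : ∀ x y, F x y b = y)
    (hF : ∀ x y k, k ≠ a → k ≠ b → F x y k = F y x k) :
    IsSwap (vv^2) ((Finsupp.lift (TB n d) (LaurentPolynomial ℤ) _) (bop n d a b))
      (fun x y => Finsupp.single (F x y) 1) := by
  intro x y
  have hs : F x y ∘ Equiv.swap a b = F y x := by
    funext k
    simp only [Function.comp_apply, Equiv.swap_apply_def]
    split_ifs with h₁ h₂
    · rw [h₁, hb, ha]
    · rw [h₂, hb, ha]
    · exact hF _ _ _ h₁ h₂
  simp only [Finsupp.lift_apply, Finsupp.sum_single_index, zero_smul, one_smul, bop, ha, hb, hs]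
  rw [single_eq_smul_single_one _ (vv^2), single_eq_smul_single_one _ (vv^2 - 1),
    single_eq_smul_single_one _ (vv^2)]

theorem isFlip_tdop {hd : 0 < d} {l : Fin d} (hl : (l : ℕ) + 1 = d)
    (F : Fin (2*n+1) → Fin d → Fin (2*n+1)) (ha : ∀ x, F x l = x)
    (hF : ∀ x y k, k ≠ l → F x k = F y k) :
    IsFlip (vv^2) Fin.rev (fun x => (x : ℤ) - n)
      ((Finsupp.lift (TB n d) (LaurentPolynomial ℤ) _) (tdop n d hd))
      (fun x => Finsupp.single (F x) 1) := by
  intro x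
  have hd' : d - 1 < d := by omega
  obtain rfl : l = ⟨d - 1, hd'⟩ := Fin.ext (by simp; omega)
  have hs : Function.update (F x) ⟨d - 1, hd'⟩ (Fin.rev x) = F (Fin.rev x) := by
    funext k
    by_cases h : k = ⟨d - 1, hd'⟩
    · subst h; simp [ha]
    · rw [Function.update_of_ne h]; exact hF _ _ _ h
  have h₁ : (x : ℤ) - n < 0 ↔ (x : ℕ) < n := by omega
  have h₂ : (x : ℤ) - n = 0 ↔ (x : ℕ) = n := by omega
  simp only [Finsupp.lift_apply, Finsupp.sum_single_index, zero_smul, one_smul, tdop, ha, hs,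
    h₁, h₂]
  rw [single_eq_smul_single_one _ (vv^2), single_eq_smul_single_one _ (vv^2 - 1),
    single_eq_smul_single_one _ (vv^2)]

theorem end_ext {S T : Module.End (LaurentPolynomial ℤ) (TB n d)}
    (h : ∀ r, S (Finsupp.single r 1) = T (Finsupp.single r 1)) : S = T := by
  refine Finsupp.lhom_ext fun r c => ?_
  rw [single_eq_smul_single_one, map_smul, map_smul, h]

theorem TfamB_of_lt {hd : 0 < d} {i j : Fin d} (h : (j : ℕ) = i + 1) :
    TfamB n d hd i = (Finsupp.lift (TB n d) (LaurentPolynomial ℤ) _) (bop n d i j) := by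
  have hi : (i : ℕ) + 1 < d := by omega
  obtain rfl : j = ⟨(i : ℕ) + 1, hi⟩ := Fin.ext h
  rw [TfamB, dif_pos]

theorem TfamB_of_last {hd : 0 < d} {i : Fin d} (h : (i : ℕ) + 1 = d) :
    TfamB n d hd i = (Finsupp.lift (TB n d) (LaurentPolynomial ℤ) _) (tdop n d hd) := by
  rw [TfamB, dif_neg (by omega)]

theorem rev_sub (x : Fin (2*n+1)) : ((Fin.rev x : Fin (2*n+1)) : ℤ) - n = -((x : ℤ) - n) := by
  have := Fin.val_rev x
  omega

theorem lt_iff_sub_lt (x y : Fin (2*n+1)) : x < y ↔ (x : ℤ) - n < (y : ℤ) - n := by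
  rw [Fin.lt_def]; omega

theorem TfamB_quadratic (hd : 0 < d) (i : Fin d) (r : Fin d → Fin (2*n+1)) :
    TfamB n d hd i (TfamB n d hd i (Finsupp.single r 1)) =
      (vv^2 - 1) • TfamB n d hd i (Finsupp.single r 1) + vv^2 • Finsupp.single r 1 := by
  by_cases h : (i : ℕ) + 1 < d
  · obtain ⟨j, hj⟩ : ∃ j : Fin d, (j : ℕ) = i + 1 := ⟨⟨i + 1, h⟩, rfl⟩
    have hij : i ≠ j := by rintro rfl; omega
    rw [TfamB_of_lt hj]
    simpa using (isSwap_bop (a := i) (b := j)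
      (fun x y => Function.update (Function.update r i x) j y)
      (by simp [hij]) (by simp) (by simp +contextual)).quadratic (r i) (r j)
  · have hi : (i : ℕ) + 1 = d := by omega
    rw [TfamB_of_last hi]
    simpa using (isFlip_tdop (hd := hd) hi (fun x => Function.update r i x)
      (by simp) (by simp +contextual)).quadratic Fin.rev_rev rev_sub (r i)

theorem TfamB_braid (hd : 0 < d) {i j : Fin d} (hij : (j : ℕ) = i + 1) (hi : (i : ℕ) + 2 < d) :
    TfamB n d hd i * TfamB n d hd j * TfamB n d hd i
      = TfamB n d hd j * TfamB n d hd i * TfamB n d hd j := by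
  obtain ⟨k, hk⟩ : ∃ k : Fin d, (k : ℕ) = j + 1 := ⟨⟨j + 1, by omega⟩, rfl⟩
  have h₁ : i ≠ j := by rintro rfl; omega
  have h₂ : i ≠ k := by rintro rfl; omega
  have h₃ : j ≠ k := by rintro rfl; omega
  refine end_ext fun r => ?_
  rw [TfamB_of_lt hij, TfamB_of_lt hk]
  simpa using IsSwap.braid
    (E := fun x y z => Finsupp.single
      (Function.update (Function.update (Function.update r i x) j y) k z) 1)
    (fun z => isSwap_bop (a := i) (b := j)
      (fun x y => Function.update (Function.update (Function.update r i x) j y) k z)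
      (by simp [*]) (by simp [*]) (by simp +contextual [Function.update_apply]))
    (fun x => isSwap_bop (a := j) (b := k)
      (fun y z => Function.update (Function.update (Function.update r i x) j y) k z)
      (by simp [*]) (by simp [*]) (by simp +contextual [Function.update_apply]))
    (r i) (r j) (r k)

theorem TfamB_commute (hd : 0 < d) {i j : Fin d} (hij : (i : ℕ) + 1 < j) :
    TfamB n d hd i * TfamB n d hd j = TfamB n d hd j * TfamB n d hd i := by
  obtain ⟨k, hk⟩ : ∃ k : Fin d, (k : ℕ) = i + 1 := ⟨⟨i + 1, by omega⟩, rfl⟩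
  have h₁ : i ≠ k := by rintro rfl; omega
  have h₂ : i ≠ j := by rintro rfl; omega
  have h₃ : k ≠ j := by rintro rfl; omega
  refine end_ext fun r => ?_
  rw [TfamB_of_lt hk]
  by_cases h : (j : ℕ) + 1 < d
  · obtain ⟨l, hl⟩ : ∃ l : Fin d, (l : ℕ) = j + 1 := ⟨⟨j + 1, h⟩, rfl⟩
    have h₄ : i ≠ l := by rintro rfl; omega
    have h₅ : k ≠ l := by rintro rfl; omega
    have h₆ : j ≠ l := by rintro rfl; omega
    rw [TfamB_of_lt hl]
    simpa using IsSwap.commute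
      (E := fun x y z w => Finsupp.single (Function.update (Function.update
        (Function.update (Function.update r i x) k y) j z) l w) 1)
      (fun z w => isSwap_bop (a := i) (b := k)
        (fun x y => Function.update (Function.update
          (Function.update (Function.update r i x) k y) j z) l w)
        (by simp [*]) (by simp [*]) (by simp +contextual [Function.update_apply]))
      (fun x y => isSwap_bop (a := j) (b := l)
        (fun z w => Function.update (Function.update
          (Function.update (Function.update r i x) k y) j z) l w)
        (by simp [*]) (by simp [*]) (by simp +contextual [Function.update_apply]))
      (r i) (r k) (r j) (r l)
  · have hj : (j : ℕ) + 1 = d := by omega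
    rw [TfamB_of_last hj]
    simpa using IsSwap.commute_isFlip
      (E := fun x y z => Finsupp.single
        (Function.update (Function.update (Function.update r i x) k y) j z) 1)
      (fun z => isSwap_bop (a := i) (b := k)
        (fun x y => Function.update (Function.update (Function.update r i x) k y) j z)
        (by simp [*]) (by simp [*]) (by simp +contextual [Function.update_apply]))
      (fun x y => isFlip_tdop (hd := hd) hj
        (fun z => Function.update (Function.update (Function.update r i x) k y) j z)
        (by simp) (by simp +contextual))
      (r i) (r k) (r j)

theorem TfamB_braid_last (hd : 0 < d) {i j : Fin d} (hij : (j : ℕ) = i + 1)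
    (hj : (j : ℕ) + 1 = d) :
    TfamB n d hd j * TfamB n d hd i * TfamB n d hd j * TfamB n d hd i
      = TfamB n d hd i * TfamB n d hd j * TfamB n d hd i * TfamB n d hd j := by
  have h₁ : i ≠ j := by rintro rfl; omega
  refine end_ext fun r => ?_
  rw [TfamB_of_lt hij, TfamB_of_last hj]
  simpa using IsSwap.braid_isFlip
    (E := fun x y => Finsupp.single (Function.update (Function.update r i x) j y) 1)
    (isSwap_bop (a := i) (b := j) (fun x y => Function.update (Function.update r i x) j y)
      (by simp [*]) (by simp) (by simp +contextual))
    (fun x => isFlip_tdop (hd := hd) hj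
      (fun y => Function.update (Function.update r i x) j y) (by simp) (by simp +contextual))
    Fin.rev_rev rev_sub lt_iff_sub_lt (r i) (r j)

end TensorSpace

/-- The operators `T_1,…,T_d` on the tensor space `𝐓` satisfy the defining relations of
the Iwahori–Hecke algebra of type `B_d`, i.e. they define a right `H_{B_d}`-module
structure on `𝐓`. -/
theorem stmt3 (n d : ℕ) (hn : 0 < n) (hd : 0 < d) :
    -- quadratic relations
    (∀ i : Fin d, (TfamB n d hd i - vv^2 • 1) * (TfamB n d hd i + 1) = 0)
    -- braid relations among `T_1,…,T_{d−1}`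
    ∧ (∀ i j : Fin d, (j : ℕ) = (i : ℕ) + 1 → (i : ℕ) + 2 < d →
        TfamB n d hd i * TfamB n d hd j * TfamB n d hd i
          = TfamB n d hd j * TfamB n d hd i * TfamB n d hd j)
    -- commutation for distant indices
    ∧ (∀ i j : Fin d, ((i : ℕ) + 1 < (j : ℕ) ∨ (j : ℕ) + 1 < (i : ℕ)) →
        TfamB n d hd i * TfamB n d hd j = TfamB n d hd j * TfamB n d hd i)
    -- the type `B` braid relation `T_d T_{d−1} T_d T_{d−1} = T_{d−1} T_d T_{d−1} T_d`
    ∧ (∀ h2 : 2 ≤ d,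
        TfamB n d hd ⟨d-1, by omega⟩ * TfamB n d hd ⟨d-2, by omega⟩
            * TfamB n d hd ⟨d-1, by omega⟩ * TfamB n d hd ⟨d-2, by omega⟩
          = TfamB n d hd ⟨d-2, by omega⟩ * TfamB n d hd ⟨d-1, by omega⟩
            * TfamB n d hd ⟨d-2, by omega⟩ * TfamB n d hd ⟨d-1, by omega⟩) := by
  refine ⟨fun i => end_ext fun r => ?_, fun i j hij hi => TfamB_braid hd hij hi, ?_,
    fun h2 => TfamB_braid_last hd (by simp; omega) (by simp; omega)⟩
  · have h := TfamB_quadratic hd i r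
    simp only [Module.End.mul_apply, LinearMap.sub_apply, LinearMap.add_apply,
      LinearMap.smul_apply, Module.End.one_apply, LinearMap.zero_apply, map_add, h]
    module
  · rintro i j (h | h)
    · exact TfamB_commute hd h
    · exact (TfamB_commute hd h).symm
end
end

section
/- For every A=(a_{ij}) ∈ Ξ_d one has the identity (in the rational numbers): d(A) − r(A) = Σ a_{ij}a_{kl} over quadruples (i,j,k,l) with i>k, j<l, i+k<N+1, plus Σ a_{ij}a_{il} over triples (i,j,l) with j<l and (i<n+1 or j<N+1−l), plus Σ a_{ij}(a_{ij}−1)/2 over pairs (i,j) with i≥n+1 and j<n+1. -/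
open Finset

/-- The dimension `d(A)` of the orbit `𝒪_A` (Lemma on orbit dimensions), written as an
explicit rational expression in the entries of `A` (indices are 1-based, `N = 2n+1`). -/
noncomputable def dFun (n : ℕ) (a : ℕ → ℕ → ℕ) : ℚ :=
  (∑ i ∈ Icc 1 (2*n+1), ∑ j ∈ Icc 1 (2*n+1), ∑ k ∈ Icc 1 (2*n+1), ∑ l ∈ Icc 1 (2*n+1),
      if i + k < 2*n+2 ∧ (i < k ∨ (k ≤ i ∧ j < l)) then (a i j * a k l : ℚ) else 0)
  + (∑ i ∈ Icc 1 (2*n+1), ∑ j ∈ Icc 1 (2*n+1), ∑ k ∈ Icc 1 (2*n+1), ∑ l ∈ Icc 1 (2*n+1),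
      if i + k = 2*n+2 ∧ j + l < 2*n+2 ∧ (i < k ∨ (k ≤ i ∧ j < l)) then
        (a i j * a k l : ℚ) else 0)
  + (∑ i ∈ Icc 1 (2*n+1), ∑ j ∈ Icc 1 (2*n+1),
      if i < n+1 ∨ j < n+1 then (a i j : ℚ) * ((a i j : ℚ) - 1) / 2 else 0)

/-- The dimension `r(A)` of the image of `𝒪_A` under the first projection, written as an
explicit rational expression in the entries of `A` (indices are 1-based, `N = 2n+1`). -/
noncomputable def rFun (n : ℕ) (a : ℕ → ℕ → ℕ) : ℚ :=
  (∑ i ∈ Icc 1 (2*n+1), ∑ j ∈ Icc 1 (2*n+1), ∑ k ∈ Icc 1 (2*n+1), ∑ l ∈ Icc 1 (2*n+1),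
      if i < k ∧ i + k < 2*n+2 then (a i j * a k l : ℚ) else 0)
  + (1/2) * (∑ i ∈ Icc 1 (2*n+1), ∑ j ∈ Icc 1 (2*n+1), ∑ l ∈ Icc 1 (2*n+1),
      if i < n+1 then (a i j * a i l : ℚ) else 0)
  - (1/2) * (∑ i ∈ Icc 1 (2*n+1), ∑ j ∈ Icc 1 (2*n+1), if i < n+1 then (a i j : ℚ) else 0)

/-- The part of the first sum of `dFun` that is not in `rFun` splits into `k < i` and `k = i`. -/
theorem sum_orbit_split (n : ℕ) (a : ℕ → ℕ → ℚ) :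
    (∑ i ∈ Icc 1 (2*n+1), ∑ j ∈ Icc 1 (2*n+1), ∑ k ∈ Icc 1 (2*n+1), ∑ l ∈ Icc 1 (2*n+1),
      if i + k < 2*n+2 ∧ (i < k ∨ (k ≤ i ∧ j < l)) then a i j * a k l else 0)
    = (∑ i ∈ Icc 1 (2*n+1), ∑ j ∈ Icc 1 (2*n+1), ∑ k ∈ Icc 1 (2*n+1), ∑ l ∈ Icc 1 (2*n+1),
        if i < k ∧ i + k < 2*n+2 then a i j * a k l else 0)
      + (∑ i ∈ Icc 1 (2*n+1), ∑ j ∈ Icc 1 (2*n+1), ∑ k ∈ Icc 1 (2*n+1), ∑ l ∈ Icc 1 (2*n+1),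
        if k < i ∧ j < l ∧ i + k < 2*n+2 then a i j * a k l else 0)
      + ∑ i ∈ Icc 1 (2*n+1), ∑ j ∈ Icc 1 (2*n+1), ∑ l ∈ Icc 1 (2*n+1),
        if i < n+1 ∧ j < l then a i j * a i l else 0 := by
  rw [← sum_add_distrib, ← sum_add_distrib]
  refine sum_congr rfl fun i hi => ?_
  rw [← sum_add_distrib, ← sum_add_distrib]
  refine sum_congr rfl fun j _ => ?_
  have hdiag : (∑ l ∈ Icc 1 (2*n+1), if i < n+1 ∧ j < l then a i j * a i l else 0)
      = ∑ k ∈ Icc 1 (2*n+1), ∑ l ∈ Icc 1 (2*n+1),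
        if k = i ∧ i < n+1 ∧ j < l then a i j * a k l else 0 := by
    symm
    rw [sum_eq_single_of_mem i hi fun k _ hk => by simp [hk]]
    simp
  rw [hdiag]
  simp only [← sum_add_distrib]
  refine sum_congr rfl fun k _ => sum_congr rfl fun l _ => ?_
  rcases lt_trichotomy i k with h | rfl | h
  · simp [h, h.not_gt, h.ne']
  · have hi' : i + i < 2*n+2 ↔ i < n+1 := by omega
    simp [hi']
  · simp [h, h.le, h.not_gt, h.ne, and_comm]

/-- Reflecting the second factor turns the antidiagonal sum of `dFun` into a sum along rows. -/
theorem sum_antidiagonal_reflect (n : ℕ) (a : ℕ → ℕ → ℚ)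
    (hsym : ∀ i ∈ Icc 1 (2*n+1), ∀ j ∈ Icc 1 (2*n+1), a i j = a (2*n+2 - i) (2*n+2 - j)) :
    (∑ i ∈ Icc 1 (2*n+1), ∑ j ∈ Icc 1 (2*n+1), ∑ k ∈ Icc 1 (2*n+1), ∑ l ∈ Icc 1 (2*n+1),
      if i + k = 2*n+2 ∧ j + l < 2*n+2 ∧ (i < k ∨ (k ≤ i ∧ j < l)) then a i j * a k l else 0)
    = ∑ i ∈ Icc 1 (2*n+1), ∑ j ∈ Icc 1 (2*n+1), ∑ l ∈ Icc 1 (2*n+1),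
        if j < l ∧ (i < n+1 ∨ j < 2*n+2 - l) then a i j * a i l else 0 := by
  refine sum_congr rfl fun i hi => sum_congr rfl fun j _ => ?_
  have hi' := mem_Icc.1 hi
  rw [sum_eq_single_of_mem (2*n+2 - i) (mem_Icc.2 ⟨by omega, by omega⟩) fun k _ hk =>
    sum_eq_zero fun l _ => if_neg fun h => hk (by omega)]
  refine sum_nbij' (fun l => 2*n+2 - l) (fun l => 2*n+2 - l) ?_ ?_ ?_ ?_ ?_
  any_goals intro l hl; simp only [mem_Icc] at hl ⊢; omega
  intro l hl
  rw [hsym i hi (2*n+2 - l) (by simp only [mem_Icc] at hl ⊢; omega)]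
  have hl' := mem_Icc.1 hl
  rw [show 2*n+2 - (2*n+2 - l) = l by omega]
  exact if_congr (by omega) rfl rfl

/-- Twice the sum over pairs `j < l` is the full square minus the diagonal. -/
theorem two_mul_sum_lt_mul (s : Finset ℕ) (f : ℕ → ℚ) :
    2 * (∑ j ∈ s, ∑ l ∈ s, if j < l then f j * f l else 0)
      = (∑ j ∈ s, ∑ l ∈ s, f j * f l) - ∑ j ∈ s, f j * f j := by
  have hswap : (∑ j ∈ s, ∑ l ∈ s, if j < l then f j * f l else 0)
      = ∑ j ∈ s, ∑ l ∈ s, if l < j then f j * f l else 0 := by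
    rw [sum_comm]
    simp only [mul_comm]
  have hdiag : ∑ j ∈ s, f j * f j = ∑ j ∈ s, ∑ l ∈ s, if j = l then f j * f l else 0 :=
    sum_congr rfl fun j hj => by rw [sum_ite_eq, if_pos hj]
  rw [two_mul, eq_sub_iff_add_eq, hdiag]
  nth_rewrite 2 [hswap]
  simp only [← sum_add_distrib]
  refine sum_congr rfl fun j _ => sum_congr rfl fun l _ => ?_
  rcases lt_trichotomy j l with h | rfl | h
  · simp [h, h.not_gt, h.ne]
  · simp
  · simp [h, h.not_gt, h.ne']

/-- The contribution of the rows above the middle one. -/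
theorem sum_upper_rows (n : ℕ) (a : ℕ → ℕ → ℚ) :
    (∑ i ∈ Icc 1 (2*n+1), ∑ j ∈ Icc 1 (2*n+1), ∑ l ∈ Icc 1 (2*n+1),
      if i < n+1 ∧ j < l then a i j * a i l else 0)
    + (∑ i ∈ Icc 1 (2*n+1), ∑ j ∈ Icc 1 (2*n+1),
      if i < n+1 ∨ j < n+1 then a i j * (a i j - 1) / 2 else 0)
    = (1/2) * (∑ i ∈ Icc 1 (2*n+1), ∑ j ∈ Icc 1 (2*n+1), ∑ l ∈ Icc 1 (2*n+1),
        if i < n+1 then a i j * a i l else 0)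
      - (1/2) * (∑ i ∈ Icc 1 (2*n+1), ∑ j ∈ Icc 1 (2*n+1), if i < n+1 then a i j else 0)
      + ∑ i ∈ Icc 1 (2*n+1), ∑ j ∈ Icc 1 (2*n+1),
        if n+1 ≤ i ∧ j < n+1 then a i j * (a i j - 1) / 2 else 0 := by
  rw [mul_sum, mul_sum, ← sum_add_distrib, ← sum_sub_distrib, ← sum_add_distrib]
  refine sum_congr rfl fun i _ => ?_
  by_cases h : i < n+1
  · have key := two_mul_sum_lt_mul (Icc 1 (2*n+1)) (a i)
    have hbin : ∑ j ∈ Icc 1 (2*n+1), a i j * (a i j - 1) / 2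
        = (1/2) * ∑ j ∈ Icc 1 (2*n+1), a i j * a i j - (1/2) * ∑ j ∈ Icc 1 (2*n+1), a i j := by
      rw [mul_sum, mul_sum, ← sum_sub_distrib]
      exact sum_congr rfl fun j _ => by ring
    simp only [h, h.not_ge, true_and, true_or, false_and, if_true, if_false, sum_const_zero]
    linarith
  · simp [h, not_lt.1 h]

/-- For `A ∈ Ξ_d` one has
`d(A) − r(A) = Σ_{i>k, j<l, i+k<N+1} a_{ij}a_{kl} + Σ_{j<l, (i<n+1 ∨ j<N+1−l)} a_{ij}a_{il}`
`+ Σ_{i≥n+1, j<n+1} a_{ij}(a_{ij}−1)/2`. -/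
theorem stmt4 (n d : ℕ) (hn : 0 < n) (hd : 0 < d) (a : ℕ → ℕ → ℕ)
    (hsum : (∑ i ∈ Icc 1 (2*n+1), ∑ j ∈ Icc 1 (2*n+1), a i j) = 2*d+1)
    (hsym : ∀ i ∈ Icc 1 (2*n+1), ∀ j ∈ Icc 1 (2*n+1),
      a i j = a (2*n+2 - i) (2*n+2 - j)) :
    dFun n a - rFun n a
      = (∑ i ∈ Icc 1 (2*n+1), ∑ j ∈ Icc 1 (2*n+1), ∑ k ∈ Icc 1 (2*n+1), ∑ l ∈ Icc 1 (2*n+1),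
          if k < i ∧ j < l ∧ i + k < 2*n+2 then (a i j * a k l : ℚ) else 0)
        + (∑ i ∈ Icc 1 (2*n+1), ∑ j ∈ Icc 1 (2*n+1), ∑ l ∈ Icc 1 (2*n+1),
            if j < l ∧ (i < n+1 ∨ j < 2*n+2 - l) then (a i j * a i l : ℚ) else 0)
        + (∑ i ∈ Icc 1 (2*n+1), ∑ j ∈ Icc 1 (2*n+1),
            if n+1 ≤ i ∧ j < n+1 then (a i j : ℚ) * ((a i j : ℚ) - 1) / 2 else 0) := by
  have h₁ := sum_orbit_split n fun i j => (a i j : ℚ)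
  have h₂ := sum_antidiagonal_reflect n (fun i j => (a i j : ℚ))
    fun i hi j hj => congrArg Nat.cast (hsym i hi j hj)
  have h₃ := sum_upper_rows n fun i j => (a i j : ℚ)
  unfold dFun rFun
  linarith
end

section
/- For every A ∈ Ξ_d one has (in the rational numbers): 2(d_A − d_{tA}) = (1/2)·Σ_{i=1}^N (ro(A)_i² − co(A)_i²) − (1/2)·(ro(A)_{n+1} − co(A)_{n+1}), where tA denotes the transpose of A (which again lies in Ξ_d). -/
open Finset

/-- `d_A := d(A) − r(A)`. -/
noncomputable def dA (n : ℕ) (a : ℕ → ℕ → ℕ) : ℚ := dFun n a - rFun n a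

/-- The quadratic form in the entries of `b` on `{1, …, 2n+1}²` whose coefficients depend only on
the signs of `i - k`, `i + k - (2n+2)`, `j - l` and `j + l - (2n+2)`. -/
noncomputable def signForm (n : ℕ) (b : ℕ → ℕ → ℚ) (w : SignType → SignType → SignType → SignType → ℤ) : ℚ :=
  ∑ i ∈ Icc 1 (2*n+1), ∑ j ∈ Icc 1 (2*n+1), ∑ k ∈ Icc 1 (2*n+1), ∑ l ∈ Icc 1 (2*n+1),
    (w (SignType.sign ((i : ℤ) - k)) (SignType.sign ((i : ℤ) + k - (2*n+2)))
      (SignType.sign ((j : ℤ) - l)) (SignType.sign ((j : ℤ) + l - (2*n+2))) : ℚ) * (b i j * b k l)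

lemma signForm_add (n : ℕ) (b : ℕ → ℕ → ℚ)
    (v w : SignType → SignType → SignType → SignType → ℤ) :
    signForm n b (fun p q r s => v p q r s + w p q r s) = signForm n b v + signForm n b w := by
  simp only [signForm, Int.cast_add, add_mul, sum_add_distrib]

lemma signForm_transpose (n : ℕ) (b : ℕ → ℕ → ℚ)
    (w : SignType → SignType → SignType → SignType → ℤ) :
    signForm n (fun i j => b j i) w = signForm n b (fun p q r s => w r s p q) := by
  unfold signForm
  rw [sum_comm]
  refine sum_congr rfl fun i _ => sum_congr rfl fun j _ => ?_
  rw [sum_comm]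

lemma signForm_swap (n : ℕ) (b : ℕ → ℕ → ℚ)
    (w : SignType → SignType → SignType → SignType → ℤ) :
    signForm n b w = signForm n b (fun p q r s => w (-p) q (-r) s) := by
  unfold signForm
  have h : ∀ f : ℕ → ℕ → ℕ → ℕ → ℚ,
      ∑ i ∈ Icc 1 (2*n+1), ∑ j ∈ Icc 1 (2*n+1), ∑ k ∈ Icc 1 (2*n+1), ∑ l ∈ Icc 1 (2*n+1),
        f i j k l =
      ∑ i ∈ Icc 1 (2*n+1), ∑ j ∈ Icc 1 (2*n+1), ∑ k ∈ Icc 1 (2*n+1), ∑ l ∈ Icc 1 (2*n+1),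
        f k l i j := by
    intro f
    have := sum_comm (s := Icc 1 (2*n+1) ×ˢ Icc 1 (2*n+1)) (t := Icc 1 (2*n+1) ×ˢ Icc 1 (2*n+1))
      (f := fun x y => f x.1 x.2 y.1 y.2)
    simpa only [sum_product] using this
  rw [h]
  refine sum_congr rfl fun i _ => sum_congr rfl fun j _ => sum_congr rfl fun k _ =>
    sum_congr rfl fun l _ => ?_
  dsimp only
  rw [← Left.sign_neg, ← Left.sign_neg, neg_sub, neg_sub, add_comm (k : ℤ), add_comm (l : ℤ),
    mul_comm (b k l)]

lemma sum_Icc_reflect (n : ℕ) (f : ℕ → ℚ) :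
    ∑ i ∈ Icc 1 (2*n+1), f (2*n+2 - i) = ∑ i ∈ Icc 1 (2*n+1), f i := by
  refine sum_nbij' (fun i => 2*n+2 - i) (fun i => 2*n+2 - i) ?_ ?_ ?_ ?_ ?_ <;>
    simp only [mem_Icc] <;> intro i hi
  all_goals first | omega | trivial

lemma signForm_reflect (n : ℕ) (b : ℕ → ℕ → ℚ)
    (hb : ∀ i ∈ Icc 1 (2*n+1), ∀ j ∈ Icc 1 (2*n+1), b i j = b (2*n+2 - i) (2*n+2 - j))
    (w : SignType → SignType → SignType → SignType → ℤ) :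
    signForm n b w = signForm n b (fun p q r s => w (-q) (-p) (-s) (-r)) := by
  unfold signForm
  rw [← sum_Icc_reflect]
  refine sum_congr rfl fun i hi => ?_
  rw [← sum_Icc_reflect]
  refine sum_congr rfl fun j hj => sum_congr rfl fun k _ => sum_congr rfl fun l _ => ?_
  rw [← hb i hi j hj]
  rw [mem_Icc] at hi hj
  dsimp only
  rw [← Left.sign_neg, ← Left.sign_neg, ← Left.sign_neg, ← Left.sign_neg,
    Nat.cast_sub (by omega), Nat.cast_sub (by omega)]
  push_cast
  ring_nf

lemma signForm_eq_zero (n : ℕ) (b : ℕ → ℕ → ℚ)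
    (hb : ∀ i ∈ Icc 1 (2*n+1), ∀ j ∈ Icc 1 (2*n+1), b i j = b (2*n+2 - i) (2*n+2 - j))
    (w : SignType → SignType → SignType → SignType → ℤ)
    (hw : ∀ p q r s, w p q r s + w (-q) (-p) (-s) (-r) + w q p s r + w (-p) (-q) (-r) (-s)
      + (w (-p) q (-r) s + w (-q) p (-s) r + w q (-p) s (-r) + w p (-q) r (-s)) = 0) :
    signForm n b w = 0 := by
  have orbit : ∀ v : SignType → SignType → SignType → SignType → ℤ,
      signForm n b v = signForm n b (fun p q r s => v q p s r) := by
    intro v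
    rw [signForm_swap, signForm_reflect n b hb, signForm_swap]
    simp only [neg_neg]
  have h0 : signForm n b (fun p q r s =>
      w p q r s + w (-q) (-p) (-s) (-r) + w q p s r + w (-p) (-q) (-r) (-s)
      + (w (-p) q (-r) s + w (-q) p (-s) r + w q (-p) s (-r) + w p (-q) r (-s))) = 0 := by
    simp only [hw, signForm, Int.cast_zero, zero_mul, sum_const_zero]
  simp only [signForm_add] at h0
  have h1 := signForm_reflect n b hb w
  have h2 := orbit w
  have h3 := orbit (fun p q r s => w (-q) (-p) (-s) (-r))
  have h4 := signForm_swap n b w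
  have h5 := orbit (fun p q r s => w (-p) q (-r) s)
  have h6 := signForm_reflect n b hb (fun p q r s => w (-p) q (-r) s)
  have h7 := orbit (fun p q r s => w q (-p) s (-r))
  simp only [neg_neg] at *
  linarith

/-- The coefficients of the quadratic part of `2 * dA`, apart from its symmetric diagonal part. -/
def dACoeff (p q r s : SignType) : ℤ :=
  2 * (if q = -1 ∧ (p = -1 ∨ (p ≠ -1 ∧ r = -1)) then 1 else 0)
  + 2 * (if q = 0 ∧ s = -1 ∧ (p = -1 ∨ (p ≠ -1 ∧ r = -1)) then 1 else 0)
  - 2 * (if p = -1 ∧ q = -1 then 1 else 0) - (if p = 0 ∧ q = -1 then 1 else 0)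

lemma sum_row_sq (n : ℕ) (b : ℕ → ℕ → ℚ) :
    ∑ i ∈ Icc 1 (2*n+1), (∑ j ∈ Icc 1 (2*n+1), b i j) ^ 2
      = signForm n b (fun p _ _ _ => if p = 0 then 1 else 0) := by
  unfold signForm
  refine sum_congr rfl fun i hi => ?_
  rw [sq, sum_mul_sum]
  refine sum_congr rfl fun j _ => ?_
  rw [sum_eq_single_of_mem (f := fun k => ∑ l ∈ _, _ * (b i j * b k l)) i hi]
  · simp
  · intro k _ hk
    refine sum_eq_zero fun l _ => ?_
    dsimp only
    rw [if_neg (by rw [sign_eq_zero_iff]; omega)]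
    simp

lemma two_mul_sum_lower (n : ℕ) (b : ℕ → ℕ → ℚ)
    (hb : ∀ i ∈ Icc 1 (2*n+1), ∀ j ∈ Icc 1 (2*n+1), b i j = b (2*n+2 - i) (2*n+2 - j)) :
    2 * (∑ i ∈ Icc 1 (2*n+1), ∑ j ∈ Icc 1 (2*n+1), if i < n+1 then b i j else 0)
      + ∑ j ∈ Icc 1 (2*n+1), b (n+1) j = ∑ i ∈ Icc 1 (2*n+1), ∑ j ∈ Icc 1 (2*n+1), b i j := by
  have upper : (∑ i ∈ Icc 1 (2*n+1), ∑ j ∈ Icc 1 (2*n+1), if i < n+1 then b i j else 0)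
      = ∑ i ∈ Icc 1 (2*n+1), ∑ j ∈ Icc 1 (2*n+1), if n+1 < i then b i j else 0 := by
    rw [← sum_Icc_reflect]
    refine sum_congr rfl fun i hi => ?_
    rw [← sum_Icc_reflect]
    refine sum_congr rfl fun j hj => ?_
    rw [← hb i hi j hj]
    rw [mem_Icc] at hi
    exact if_congr (by omega) rfl rfl
  have middle : ∑ j ∈ Icc 1 (2*n+1), b (n+1) j
      = ∑ i ∈ Icc 1 (2*n+1), ∑ j ∈ Icc 1 (2*n+1), if i = n+1 then b i j else 0 := by
    rw [sum_eq_single_of_mem (f := fun i => ∑ j ∈ _, if i = n+1 then b i j else 0) (n+1) (by rw [mem_Icc]; omega)]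
    · simp
    · intro i _ hi
      simp [hi]
  rw [two_mul]
  nth_rewrite 2 [upper]
  rw [middle]
  simp only [← sum_add_distrib]
  refine sum_congr rfl fun i _ => sum_congr rfl fun j _ => ?_
  rcases lt_trichotomy i (n+1) with h | h | h
  · simp [h, h.ne, h.le]
  · simp [h]
  · simp [h, h.ne', h.not_gt]

lemma two_mul_dA (n : ℕ) (a : ℕ → ℕ → ℕ) :
    2 * dA n a = signForm n (fun i j => (a i j : ℚ)) dACoeff
      + 2 * (∑ i ∈ Icc 1 (2*n+1), ∑ j ∈ Icc 1 (2*n+1),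
          if i < n+1 ∨ j < n+1 then (a i j : ℚ) * ((a i j : ℚ) - 1) / 2 else 0)
      + ∑ i ∈ Icc 1 (2*n+1), ∑ j ∈ Icc 1 (2*n+1), if i < n+1 then (a i j : ℚ) else 0 := by
  have diag : (∑ i ∈ Icc 1 (2*n+1), ∑ j ∈ Icc 1 (2*n+1), ∑ l ∈ Icc 1 (2*n+1),
      if i < n+1 then (a i j * a i l : ℚ) else 0)
      = ∑ i ∈ Icc 1 (2*n+1), ∑ j ∈ Icc 1 (2*n+1), ∑ k ∈ Icc 1 (2*n+1), ∑ l ∈ Icc 1 (2*n+1),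
        if i = k ∧ i + k < 2*n+2 then (a i j * a k l : ℚ) else 0 := by
    refine sum_congr rfl fun i hi => sum_congr rfl fun j _ => ?_
    rw [sum_eq_single_of_mem
      (f := fun k => ∑ l ∈ _, if i = k ∧ i + k < 2*n+2 then (a i j * a k l : ℚ) else 0) i hi]
    · exact sum_congr rfl fun l _ => if_congr (by omega) rfl rfl
    · intro k _ hk
      exact sum_eq_zero fun l _ => if_neg fun h => hk h.1.symm
  have expand : signForm n (fun i j => (a i j : ℚ)) dACoeff
      = 2 * (∑ i ∈ Icc 1 (2*n+1), ∑ j ∈ Icc 1 (2*n+1), ∑ k ∈ Icc 1 (2*n+1),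
          ∑ l ∈ Icc 1 (2*n+1), if i + k < 2*n+2 ∧ (i < k ∨ (k ≤ i ∧ j < l)) then
            (a i j * a k l : ℚ) else 0)
        + 2 * (∑ i ∈ Icc 1 (2*n+1), ∑ j ∈ Icc 1 (2*n+1), ∑ k ∈ Icc 1 (2*n+1),
          ∑ l ∈ Icc 1 (2*n+1), if i + k = 2*n+2 ∧ j + l < 2*n+2 ∧ (i < k ∨ (k ≤ i ∧ j < l)) then
            (a i j * a k l : ℚ) else 0)
        - 2 * (∑ i ∈ Icc 1 (2*n+1), ∑ j ∈ Icc 1 (2*n+1), ∑ k ∈ Icc 1 (2*n+1),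
          ∑ l ∈ Icc 1 (2*n+1), if i < k ∧ i + k < 2*n+2 then (a i j * a k l : ℚ) else 0)
        - ∑ i ∈ Icc 1 (2*n+1), ∑ j ∈ Icc 1 (2*n+1), ∑ k ∈ Icc 1 (2*n+1),
          ∑ l ∈ Icc 1 (2*n+1), if i = k ∧ i + k < 2*n+2 then (a i j * a k l : ℚ) else 0 := by
    unfold signForm dACoeff
    simp only [mul_sum, ← sum_add_distrib, ← sum_sub_distrib]
    refine sum_congr rfl fun i _ => sum_congr rfl fun j _ => sum_congr rfl fun k _ =>
      sum_congr rfl fun l _ => ?_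
    have e1 : (i : ℤ) - k < 0 ↔ i < k := by omega
    have e2 : (i : ℤ) - k = 0 ↔ i = k := by omega
    have e3 : (i : ℤ) + k - (2*n+2) < 0 ↔ i + k < 2*n+2 := by omega
    have e4 : (i : ℤ) + k - (2*n+2) = 0 ↔ i + k = 2*n+2 := by omega
    have e5 : (j : ℤ) - l < 0 ↔ j < l := by omega
    have e6 : (j : ℤ) + l - (2*n+2) < 0 ↔ j + l < 2*n+2 := by omega
    simp only [ne_eq, sign_eq_neg_one_iff, sign_eq_zero_iff, e1, e2, e3, e4, e5, e6, not_lt]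
    push_cast
    simp only [sub_mul, add_mul, mul_assoc, ite_mul, one_mul, zero_mul]
  rw [expand, dA, dFun, rFun, diag]
  ring

/-- For `A ∈ Ξ_d` the transpose `ᵗA` again lies in `Ξ_d` and one has
`2(d_A − d_{ᵗA}) = (1/2)Σ_i (ro(A)_i² − co(A)_i²) − (1/2)(ro(A)_{n+1} − co(A)_{n+1})`. -/
theorem stmt5 (n d : ℕ) (hn : 0 < n) (hd : 0 < d) (a : ℕ → ℕ → ℕ)
    (hsum : (∑ i ∈ Icc 1 (2*n+1), ∑ j ∈ Icc 1 (2*n+1), a i j) = 2*d+1)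
    (hsym : ∀ i ∈ Icc 1 (2*n+1), ∀ j ∈ Icc 1 (2*n+1),
      a i j = a (2*n+2 - i) (2*n+2 - j)) :
    -- the transpose again lies in `Ξ_d`
    ((∑ i ∈ Icc 1 (2*n+1), ∑ j ∈ Icc 1 (2*n+1), a j i) = 2*d+1
      ∧ ∀ i ∈ Icc 1 (2*n+1), ∀ j ∈ Icc 1 (2*n+1),
          a j i = a (2*n+2 - j) (2*n+2 - i))
    -- the identity for `2(d_A − d_{ᵗA})`
    ∧ 2 * (dA n a - dA n (fun i j => a j i))
      = (1/2) * (∑ i ∈ Icc 1 (2*n+1),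
            (((∑ j ∈ Icc 1 (2*n+1), a i j : ℕ) : ℚ)^2
              - ((∑ j ∈ Icc 1 (2*n+1), a j i : ℕ) : ℚ)^2))
        - (1/2) * (((∑ j ∈ Icc 1 (2*n+1), a (n+1) j : ℕ) : ℚ)
            - ((∑ j ∈ Icc 1 (2*n+1), a j (n+1) : ℕ) : ℚ)) := by
  have hb : ∀ i ∈ Icc 1 (2*n+1), ∀ j ∈ Icc 1 (2*n+1),
      (a i j : ℚ) = (a (2*n+2 - i) (2*n+2 - j) : ℚ) := fun i hi j hj => by rw [← hsym i hi j hj]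
  refine ⟨⟨by rw [sum_comm]; exact hsum, fun i hi j hj => hsym j hj i hi⟩, ?_⟩
  have lower := two_mul_sum_lower n (fun i j => (a i j : ℚ)) hb
  have lower_transpose := two_mul_sum_lower n (fun i j => (a j i : ℚ))
    fun i hi j hj => hb j hj i hi
  have total := sum_comm (s := Icc 1 (2*n+1)) (t := Icc 1 (2*n+1)) (f := fun i j => (a i j : ℚ))
  have diagonal : (∑ i ∈ Icc 1 (2*n+1), ∑ j ∈ Icc 1 (2*n+1),
        if i < n+1 ∨ j < n+1 then (a j i : ℚ) * ((a j i : ℚ) - 1) / 2 else 0)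
      = ∑ i ∈ Icc 1 (2*n+1), ∑ j ∈ Icc 1 (2*n+1),
        if i < n+1 ∨ j < n+1 then (a i j : ℚ) * ((a i j : ℚ) - 1) / 2 else 0 := by
    rw [sum_comm]
    simp only [or_comm]
  have quadratic := signForm_eq_zero n (fun i j => (a i j : ℚ)) hb
    (fun p q r s => dACoeff p q r s + dACoeff p q r s + (if r = 0 then 1 else 0)
      + -1 * (dACoeff r s p q + dACoeff r s p q + (if p = 0 then 1 else 0))) (by decide)
  have neg_form : ∀ v : SignType → SignType → SignType → SignType → ℤ,
      signForm n (fun i j => (a i j : ℚ)) (fun p q r s => -1 * v p q r s)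
        = -signForm n (fun i j => (a i j : ℚ)) v := fun v => by
    simp [signForm]
  simp only [signForm_add, neg_form] at quadratic
  rw [mul_sub, two_mul_dA, two_mul_dA, diagonal,
    signForm_transpose n (fun i j => (a i j : ℚ)), sum_sub_distrib]
  push_cast
  rw [sum_row_sq n (fun i j => (a i j : ℚ)), sum_row_sq n (fun i j => (a j i : ℚ)),
    signForm_transpose n (fun i j => (a i j : ℚ))]
  linarith
end

section
/- For every odd integer a ≥ 1 and every natural number t, the element ∏_{i=0}^{t−1} [a+1+2i]/[i+1] of Q(v) lies in the subring Z[v, v^{-1}] of Laurent polynomials. -/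
/-- The quantum integer `[m] = (v^{2m} − 1)/(v² − 1)` in `ℚ(v)`. -/
noncomputable def qint (m : ℕ) : RatFunc ℚ :=
  (RatFunc.X ^ (2 * m) - 1) / (RatFunc.X ^ 2 - 1)

/-- The Gaussian binomial coefficient `∏_{i<t} (q^{n+i} − 1)/(q^{i+1} − 1)` is a polynomial in `q`
with integer coefficients: it lies in every subring containing `q`. -/
theorem gaussBinom_mem {K : Type*} [Field K] (S : Subring K) {q : K} (hq : q ∈ S)
    (hq1 : ∀ i : ℕ, q ^ (i + 1) - 1 ≠ 0) (n t : ℕ) :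
    (∏ i ∈ Finset.range t, (q ^ (n + i) - 1) / (q ^ (i + 1) - 1)) ∈ S := by
  induction n generalizing t with
  | zero =>
    cases t with
    | zero => simp
    | succ t => simp [Finset.prod_range_succ']
  | succ n ihn =>
    induction t with
    | zero => simp
    | succ t iht =>
      have pascal : (∏ i ∈ Finset.range (t + 1), (q ^ (n + 1 + i) - 1) / (q ^ (i + 1) - 1)) =
          (∏ i ∈ Finset.range (t + 1), (q ^ (n + i) - 1) / (q ^ (i + 1) - 1)) +
          q ^ n * ∏ i ∈ Finset.range t, (q ^ (n + 1 + i) - 1) / (q ^ (i + 1) - 1) := by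
        have shift : (∏ i ∈ Finset.range (t + 1), (q ^ (n + i) - 1)) =
            (∏ i ∈ Finset.range t, (q ^ (n + 1 + i) - 1)) * (q ^ n - 1) := by
          rw [Finset.prod_range_succ']
          simp only [add_zero, add_assoc, add_comm 1]
        have hprod : (∏ i ∈ Finset.range t, (q ^ (i + 1) - 1)) ≠ 0 :=
          Finset.prod_ne_zero_iff.mpr fun i _ => hq1 i
        have ht := hq1 t
        simp only [Finset.prod_div_distrib]
        rw [shift, Finset.prod_range_succ (fun i => q ^ (i + 1) - 1),
          Finset.prod_range_succ (fun i => q ^ (n + 1 + i) - 1)]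
        field_simp
        ring
      rw [pascal]
      exact S.add_mem (ihn _) (S.mul_mem (S.pow_mem hq n) iht)

theorem RatFunc.X_pow_succ_sub_one_ne_zero (K : Type*) [Field K] (n : ℕ) :
    (RatFunc.X : RatFunc K) ^ (n + 1) - 1 ≠ 0 := by
  have h := (Polynomial.monic_X_pow_sub_C (1 : K) n.succ_ne_zero).ne_zero
  intro h0
  apply h
  apply RatFunc.algebraMap_injective K
  simpa using h0

/-- For every odd integer `a ≥ 1` and every natural number `t`, the element
`∏_{i=0}^{t−1} [a+1+2i]/[i+1]` of `ℚ(v)` lies in the subring `ℤ[v,v⁻¹]`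
(the subring of `ℚ(v)` generated by `v` and `v⁻¹`). -/
theorem stmt6 (a : ℕ) (ha : Odd a) (ha1 : 1 ≤ a) (t : ℕ) :
    (∏ i ∈ Finset.range t, qint (a + 1 + 2 * i) / qint (i + 1)) ∈
      Subring.closure ({RatFunc.X, (RatFunc.X)⁻¹} : Set (RatFunc ℚ)) := by
  obtain ⟨k, rfl⟩ := ha
  set S := Subring.closure ({RatFunc.X, (RatFunc.X)⁻¹} : Set (RatFunc ℚ))
  have hX : (RatFunc.X : RatFunc ℚ) ∈ S := Subring.subset_closure (by simp)
  have hq : (RatFunc.X : RatFunc ℚ) ^ 2 ∈ S := S.pow_mem hX 2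
  have hq1 : ∀ i : ℕ, ((RatFunc.X : RatFunc ℚ) ^ 2) ^ (i + 1) - 1 ≠ 0 := fun i => by
    rw [← pow_mul]
    exact RatFunc.X_pow_succ_sub_one_ne_zero ℚ (2 * i + 1)
  have factor : ∀ i : ℕ, qint (2 * k + 1 + 1 + 2 * i) / qint (i + 1) =
      ((RatFunc.X ^ 2) ^ (k + 1 + i) - 1) / ((RatFunc.X ^ 2) ^ (i + 1) - 1) *
        ((RatFunc.X ^ 2) ^ (k + 1 + i) + 1) := fun i => by
    have h1 : (RatFunc.X : RatFunc ℚ) ^ 2 - 1 ≠ 0 := by simpa using hq1 0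
    rw [qint, qint, div_div_div_cancel_right₀ h1, pow_mul _ 2 (i + 1), div_mul_eq_mul_div]
    congr 1
    ring
  simp only [factor, Finset.prod_mul_distrib]
  exact S.mul_mem (gaussBinom_mem S hq hq1 (k + 1) t)
    (S.prod_mem fun i _ => S.add_mem (S.pow_mem hq _) S.one_mem)
end

section
/- There exists a map ψ: U^j → U^j which is a ring homomorphism, is semilinear with respect to the bar automorphism of Q(v) (i.e., ψ(c·u) = c̄·ψ(u) for c ∈ Q(v), u ∈ U^j), satisfies ψ∘ψ = id, and sends d_a ↦ d_a^{-1}, e_i ↦ e_i, f_i ↦ f_i for all 1≤a≤n+1 and 1≤i≤n (the anti-linear bar involution of U^j). -/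
noncomputable section

/-- `v`, the generator of `ℚ(v)`. -/
def v : RatFunc ℚ := RatFunc.X

/-- `v^z` for `z ∈ ℤ`. -/
def vpow (z : ℤ) : RatFunc ℚ := v ^ z

/-- Generators of the coideal algebra `U^ȷ` (here `N = 2n+1`):
`e_i, f_i` for `1 ≤ i ≤ n` and `d_a, d_a^{-1}` for `1 ≤ a ≤ n+1`
(the index `i : Fin n` corresponds to the 1-based index `i+1`, and similarly for `a`). -/
inductive JGen (n : ℕ) : Type
  | e : Fin n → JGen n
  | f : Fin n → JGen n
  | d : Fin (n+1) → JGen n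
  | dinv : Fin (n+1) → JGen n

/-- The generators inside the free algebra. -/
def jι (n : ℕ) (x : JGen n) : FreeAlgebra (RatFunc ℚ) (JGen n) :=
  FreeAlgebra.ι _ x

/-- The exponent `−δ_{a,j+1} − δ_{N+1−a,j+1} + δ_{a,j}` (all indices 1-based,
`N = 2n+1`). -/
def expE (n : ℕ) (a : Fin (n+1)) (j : Fin n) : ℤ :=
  (if (a : ℕ) = (j : ℕ) + 1 then -1 else 0)
    + (if 2*n+1 - (a : ℕ) = (j : ℕ) + 2 then -1 else 0)
    + (if (a : ℕ) = (j : ℕ) then 1 else 0)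

/-- The defining relations of the coideal algebra `U^ȷ` inside the free algebra on the
generators `e_i, f_i, d_a, d_a^{-1}`. -/
inductive JRel (n : ℕ) :
    FreeAlgebra (RatFunc ℚ) (JGen n) → FreeAlgebra (RatFunc ℚ) (JGen n) → Prop
  | dd_inv (a : Fin (n+1)) : JRel n (jι n (.d a) * jι n (.dinv a)) 1
  | dinv_d (a : Fin (n+1)) : JRel n (jι n (.dinv a) * jι n (.d a)) 1
  | d_comm (a b : Fin (n+1)) :
      JRel n (jι n (.d a) * jι n (.d b)) (jι n (.d b) * jι n (.d a))
  | de (a : Fin (n+1)) (j : Fin n) :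
      JRel n (jι n (.d a) * jι n (.e j) * jι n (.dinv a))
        (vpow (expE n a j) • jι n (.e j))
  | df (a : Fin (n+1)) (j : Fin n) :
      JRel n (jι n (.d a) * jι n (.f j) * jι n (.dinv a))
        (vpow (-(expE n a j)) • jι n (.f j))
  | ef (i j : Fin n) (hi : (i : ℕ) ≠ n - 1) (hj : (j : ℕ) ≠ n - 1) :
      JRel n (jι n (.e i) * jι n (.f j) - jι n (.f j) * jι n (.e i))
        (if i = j then
          (v - v⁻¹)⁻¹ •
            (jι n (.d i.castSucc) * jι n (.dinv i.succ)
              - jι n (.dinv i.castSucc) * jι n (.d i.succ))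
         else 0)
  | serre_e (i j : Fin n) (h : (i : ℕ) + 1 = (j : ℕ) ∨ (j : ℕ) + 1 = (i : ℕ)) :
      JRel n (jι n (.e i) * jι n (.e i) * jι n (.e j)
          + jι n (.e j) * jι n (.e i) * jι n (.e i))
        ((v + v⁻¹) • (jι n (.e i) * jι n (.e j) * jι n (.e i)))
  | serre_f (i j : Fin n) (h : (i : ℕ) + 1 = (j : ℕ) ∨ (j : ℕ) + 1 = (i : ℕ)) :
      JRel n (jι n (.f i) * jι n (.f i) * jι n (.f j)
          + jι n (.f j) * jι n (.f i) * jι n (.f i))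
        ((v + v⁻¹) • (jι n (.f i) * jι n (.f j) * jι n (.f i)))
  | comm_e (i j : Fin n) (h : (i : ℕ) + 1 < (j : ℕ) ∨ (j : ℕ) + 1 < (i : ℕ)) :
      JRel n (jι n (.e i) * jι n (.e j)) (jι n (.e j) * jι n (.e i))
  | comm_f (i j : Fin n) (h : (i : ℕ) + 1 < (j : ℕ) ∨ (j : ℕ) + 1 < (i : ℕ)) :
      JRel n (jι n (.f i) * jι n (.f j)) (jι n (.f j) * jι n (.f i))
  | fn_rel (i : Fin n) (h : (i : ℕ) = n - 1) :
      JRel n (jι n (.f i) * jι n (.f i) * jι n (.e i)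
          + jι n (.e i) * jι n (.f i) * jι n (.f i))
        ((v + v⁻¹) •
          (jι n (.f i) * jι n (.e i) * jι n (.f i)
            - (v • (jι n (.d i.castSucc) * jι n (.dinv i.succ))
                + v⁻¹ • (jι n (.dinv i.castSucc) * jι n (.d i.succ)))
              * jι n (.f i)))
  | en_rel (i : Fin n) (h : (i : ℕ) = n - 1) :
      JRel n (jι n (.e i) * jι n (.e i) * jι n (.f i)
          + jι n (.f i) * jι n (.e i) * jι n (.e i))
        ((v + v⁻¹) •
          (jι n (.e i) * jι n (.f i) * jι n (.e i)
            - jι n (.e i)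
              * (v • (jι n (.d i.castSucc) * jι n (.dinv i.succ))
                + v⁻¹ • (jι n (.dinv i.castSucc) * jι n (.d i.succ)))))

/-- The coideal algebra `U^ȷ`, presented by generators and relations. -/
abbrev Uj (n : ℕ) := RingQuot (JRel n)

/-- The generators of `U^ȷ` as elements of `U^ȷ`. -/
def jg (n : ℕ) (x : JGen n) : Uj n :=
  RingQuot.mkAlgHom (RatFunc ℚ) (JRel n) (FreeAlgebra.ι _ x)

/-- The universal property of a `RingQuot` of a free algebra, for ring homomorphisms whose
restriction to the base ring is a prescribed central homomorphism `σ`. -/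
theorem exists_ringHom_ringQuot {R B X : Type*} [CommRing R] [Ring B]
    (r : FreeAlgebra R X → FreeAlgebra R X → Prop) (σ : R →+* B)
    (hσ : ∀ c b, σ c * b = b * σ c) (φ : X → B)
    (h : ∀ g : FreeAlgebra R X →+* B, (∀ c, g (algebraMap R _ c) = σ c) →
      (∀ x, g (FreeAlgebra.ι R x) = φ x) → ∀ a b, r a b → g a = g b) :
    ∃ ψ : RingQuot r →+* B, (∀ c, ψ (algebraMap R _ c) = σ c) ∧
      ∀ x, ψ (RingQuot.mkAlgHom R r (FreeAlgebra.ι R x)) = φ x := by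
  let : Algebra R B := σ.toAlgebra' hσ
  have hg : ∀ a b, r a b → FreeAlgebra.lift R φ a = FreeAlgebra.lift R φ b :=
    h (FreeAlgebra.lift R φ : FreeAlgebra R X →ₐ[R] B).toRingHom
      (fun c => (FreeAlgebra.lift R φ).commutes c) (fun x => FreeAlgebra.lift_ι_apply φ x)
  refine ⟨(RingQuot.liftAlgHom R ⟨FreeAlgebra.lift R φ, fun a b => hg a b⟩).toRingHom,
    fun c => AlgHom.commutes _ c, fun x => ?_⟩
  exact (RingQuot.liftAlgHom_mkAlgHom_apply R _ _ _).trans (FreeAlgebra.lift_ι_apply φ x)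

/-- A ring endomorphism of `ℚ(v)` inverting `v` is an involution. -/
theorem bar_bar {bar : RatFunc ℚ →+* RatFunc ℚ} (hbar : bar RatFunc.X = (RatFunc.X)⁻¹)
    (c : RatFunc ℚ) : bar (bar c) = c := by
  suffices H : bar.comp bar = RingHom.id _ from DFunLike.congr_fun H c
  refine IsLocalization.ringHom_ext (nonZeroDivisors (Polynomial ℚ)) ?_
  refine Polynomial.ringHom_ext (fun a => ?_) ?_
  · simp
  · simp [RatFunc.algebraMap_X, hbar]

/-- Conjugation by the inverse scales by the inverse factor. -/
theorem inv_conj_eq_smul {K A : Type*} [Field K] [Ring A] [Algebra K A] {d d' x : A} {c : K}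
    (h₁ : d' * d = 1) (hc : c ≠ 0) (h : d * x * d' = c • x) : d' * x * d = c⁻¹ • x := by
  have : x = c • (d' * x * d) :=
    calc x = (d' * d) * x * (d' * d) := by simp [h₁]
      _ = d' * (d * x * d') * d := by simp only [mul_assoc]
      _ = c • (d' * x * d) := by rw [h]; simp
  rw [eq_inv_smul_iff₀ hc, ← this]

theorem inv_sub_smul_sub_comm {K A : Type*} [Field K] [Ring A] [Algebra K A] (a b : K)
    (x y : A) : (a - b)⁻¹ • (x - y) = (b - a)⁻¹ • (y - x) := by
  rw [← neg_sub b a, ← neg_sub y x, inv_neg, neg_smul_neg]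

/-- The inverses of commuting elements commute. -/
theorem inv_mul_inv_comm {A : Type*} [Monoid A] {a a' b b' : A} (ha : a * a' = 1)
    (ha' : a' * a = 1) (hb : b * b' = 1) (hb' : b' * b = 1) (h : a * b = b * a) :
    a' * b' = b' * a' := by
  let x : Aˣ := ⟨a, a', ha, ha'⟩
  let y : Aˣ := ⟨b, b', hb, hb'⟩
  have hxy : x * y = y * x := Units.ext h
  have := congrArg (fun u : Aˣ => ((u⁻¹ : Aˣ) : A)) hxy
  simpa [x, y, mul_inv_rev] using this.symm

/-- The images of the generators under the bar involution. -/
def barGen (n : ℕ) : JGen n → Uj n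
  | .e i => jg n (.e i)
  | .f i => jg n (.f i)
  | .d a => jg n (.dinv a)
  | .dinv a => jg n (.d a)

/-- A bar-semilinear ring homomorphism acting on generators by `barGen` respects the defining
relations of `U^ȷ`. -/
theorem map_eq_of_jRel (n : ℕ) {bar : RatFunc ℚ →+* RatFunc ℚ}
    (hbar : bar RatFunc.X = (RatFunc.X)⁻¹)
    (g : FreeAlgebra (RatFunc ℚ) (JGen n) →+* Uj n)
    (hc : ∀ c, g (algebraMap _ _ c) = algebraMap _ _ (bar c))
    (hx : ∀ x, g (FreeAlgebra.ι _ x) = barGen n x)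
    (a b : FreeAlgebra (RatFunc ℚ) (JGen n)) (hr : JRel n a b) : g a = g b := by
  have hs : ∀ c u, g (c • u) = bar c • g u := fun c u => by
    rw [Algebra.smul_def, map_mul, hc, ← Algebra.smul_def]
  have hι : ∀ x, g (jι n x) = barGen n x := hx
  have hv : bar v = v⁻¹ := hbar
  have hv0 : v ≠ 0 := RatFunc.X_ne_zero
  have hπ : ∀ x, RingQuot.mkAlgHom (RatFunc ℚ) (JRel n) (jι n x) = jg n x := fun _ => rfl
  have key : ∀ {a b}, JRel n a b → RingQuot.mkAlgHom (RatFunc ℚ) (JRel n) a =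
      RingQuot.mkAlgHom (RatFunc ℚ) (JRel n) b := fun h => RingQuot.mkAlgHom_rel _ h
  have hdd : ∀ a, jg n (.d a) * jg n (.dinv a) = 1 := fun a => by
    simpa [hπ] using key (.dd_inv a)
  have hdd' : ∀ a, jg n (.dinv a) * jg n (.d a) = 1 := fun a => by
    simpa [hπ] using key (.dinv_d a)
  have hpow : ∀ z, bar (vpow z) = (vpow z)⁻¹ := fun z => by
    simp [vpow, hv]
  have hπr := key hr
  cases hr with
  | dd_inv a => simpa [hι, barGen] using hdd' a
  | dinv_d a => simpa [hι, barGen] using hdd a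
  | d_comm a b =>
    simp only [map_mul, hπ] at hπr
    simpa [hι, barGen] using
      inv_mul_inv_comm (hdd a) (hdd' a) (hdd b) (hdd' b) hπr
  | de a j =>
    simp only [map_mul, map_smul, hπ] at hπr
    simp only [map_mul, hs, hι, hpow, barGen]
    exact inv_conj_eq_smul (hdd' a) (zpow_ne_zero _ hv0) hπr
  | df a j =>
    simp only [map_mul, map_smul, hπ] at hπr
    simp only [map_mul, hs, hι, hpow, barGen]
    exact inv_conj_eq_smul (hdd' a) (zpow_ne_zero _ hv0) hπr
  | ef i j hi hj =>
    by_cases hij : i = j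
    · subst hij
      simp only [if_true, map_sub, map_mul, map_smul, hπ] at hπr
      simp only [if_true, map_sub, map_mul, hs, hι, barGen, map_inv₀, hv, inv_inv]
      exact hπr.trans (inv_sub_smul_sub_comm _ _ _ _)
    · simpa [hij, hι, hπ, barGen] using hπr
  | serre_e i j h | serre_f i j h =>
    simp only [map_add, map_mul, map_smul, hπ] at hπr
    simp only [map_add, map_mul, hs, hι, barGen, map_inv₀, hv, inv_inv]
    rw [hπr, add_comm v]
  | comm_e i j h | comm_f i j h =>
    simp only [map_mul, hπ] at hπr
    simpa only [map_mul, hι, barGen] using hπr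
  | fn_rel i h | en_rel i h =>
    simp only [map_add, map_sub, map_mul, map_smul, hπ] at hπr
    simp only [map_add, map_sub, map_mul, hs, hι, barGen, map_inv₀, hv, inv_inv]
    rw [hπr, add_comm v, add_comm (v • _)]

/-- There is an anti-linear bar involution of `U^ȷ`: a ring homomorphism
`ψ : U^ȷ → U^ȷ`, semilinear with respect to the bar automorphism `v ↦ v⁻¹` of `ℚ(v)`,
with `ψ ∘ ψ = id`, sending `d_a ↦ d_a^{-1}`, `e_i ↦ e_i`, `f_i ↦ f_i`. -/
theorem stmt9 (n : ℕ) (hn : 0 < n)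
    (bar : RatFunc ℚ →+* RatFunc ℚ) (hbar : bar RatFunc.X = (RatFunc.X)⁻¹) :
    ∃ ψ : Uj n →+* Uj n,
      (∀ (c : RatFunc ℚ) (u : Uj n), ψ (c • u) = bar c • ψ u)
      ∧ (∀ u, ψ (ψ u) = u)
      ∧ (∀ a, ψ (jg n (.d a)) = jg n (.dinv a))
      ∧ (∀ i, ψ (jg n (.e i)) = jg n (.e i))
      ∧ (∀ i, ψ (jg n (.f i)) = jg n (.f i)) := by
  obtain ⟨ψ, hψc, hψx⟩ := exists_ringHom_ringQuot (JRel n)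
    ((algebraMap (RatFunc ℚ) (Uj n)).comp bar) (fun c b => Algebra.commutes (bar c) b) (barGen n)
    (map_eq_of_jRel n hbar)
  have hψg : ∀ x, ψ (jg n x) = barGen n x := hψx
  have hinv : AlgHom.mk (R := RatFunc ℚ) (ψ.comp ψ) (fun c => by
      simp only [RingHom.toMonoidHom_eq_coe, OneHom.toFun_eq_coe, MonoidHom.toOneHom_coe,
        MonoidHom.coe_coe, RingHom.comp_apply, hψc, bar_bar hbar]) = AlgHom.id _ (Uj n) := by
    refine RingQuot.ringQuot_ext' _ _ _ (FreeAlgebra.hom_ext (funext fun x => ?_))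
    change ψ (ψ (jg n x)) = jg n x
    cases x <;> simp [hψg, barGen]
  refine ⟨ψ, fun c u => ?_, fun u => DFunLike.congr_fun hinv u, fun a => hψg _, fun i => hψg _,
    fun i => hψg _⟩
  rw [Algebra.smul_def, map_mul, hψc, RingHom.comp_apply, ← Algebra.smul_def]
end
end
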